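/- arXiv:1707.05040 — 3 statements merged into one kernel-verified Lean document; each statement's English description precedes it below -/
import Mathlib

section
/- Let C be an abelian category with enough projectives. The full subcategory gpC of Gorenstein projective objects is projectively resolving: it contains all projectives, is closed under direct summands, and for every short exact sequence 0→X→Y→Z→0 with Z Gorenstein projective, X is Gorenstein projective if and only if Y is Gorenstein projective. -/
open CategoryTheory CategoryTheory.Limits

universe w w' v v' u u'

section Defs

variable {C : Type u} [Category.{v} C] [Abelian C]

/-- `f`, `g` form a short exact sequence `0 → X → Y → Z → 0`. -/
def IsSES {X Y Z : C} (f : X ⟶ Y) (g : Y ⟶ Z) : Prop :=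
  ∃ w : f ≫ g = 0, (ShortComplex.mk f g w).ShortExact

/-- Vanishing of the Yoneda Ext¹ group: every short exact sequence
`0 → P → E → Z → 0` splits. -/
def YonedaExt1Zero (Z P : C) : Prop :=
  ∀ (E : C) (i : P ⟶ E) (p : E ⟶ Z), IsSES i p → ∃ s : Z ⟶ E, s ≫ p = 𝟙 Z

/-- A totally acyclic complex of projectives: an exact complex of projective
objects which stays exact after applying `Hom(-, Q)` for every projective `Q`. -/
structure IsTotallyAcyclic (P : ChainComplex C ℤ) : Prop where
  projective : ∀ i, Projective (P.X i)
  acyclic : ∀ i, P.ExactAt i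
  homExact : ∀ (Q : C), Projective Q → ∀ (i : ℤ) (f : P.X i ⟶ Q),
    P.d (i + 1) i ≫ f = 0 → ∃ g : P.X (i - 1) ⟶ Q, P.d i (i - 1) ≫ g = f

/-- An object is Gorenstein projective if it is (isomorphic to) a syzygy of a
totally acyclic complex of projectives. -/
def IsGorensteinProjective (X : C) : Prop :=
  ∃ P : ChainComplex C ℤ, IsTotallyAcyclic P ∧ Nonempty (X ≅ cokernel (P.d 1 0))

/-- `X` admits a resolution of length at most `n` by objects satisfying `S`. -/
inductive HasResDimLE (S : C → Prop) : C → ℕ → Prop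
  | of_mem {X : C} (hX : S X) (n : ℕ) : HasResDimLE S X n
  | step {X K G : C} (n : ℕ) (f : K ⟶ G) (g : G ⟶ X)
      (hses : IsSES f g) (hG : S G) (hK : HasResDimLE S K n) :
      HasResDimLE S X (n + 1)

/-- The G-dimension: the minimal length of a Gorenstein projective resolution. -/
noncomputable def gDim (X : C) : ℕ∞ :=
  sInf {n : ℕ∞ | ∃ m : ℕ, n = (m : ℕ∞) ∧ HasResDimLE IsGorensteinProjective X m}

variable [HasExt.{w} C]

/-- The projective dimension: the minimal `m` such that `Ext^j(X, -)` vanishes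
for all `j > m`. -/
noncomputable def projDim (X : C) : ℕ∞ :=
  sInf {n : ℕ∞ | ∃ m : ℕ, n = (m : ℕ∞) ∧
    ∀ (Y : C) (j : ℕ), m < j → Subsingleton (Abelian.Ext X Y j)}

/-- The injective dimension: the minimal `m` such that `Ext^j(-, X)` vanishes
for all `j > m`. -/
noncomputable def injDim (X : C) : ℕ∞ :=
  sInf {n : ℕ∞ | ∃ m : ℕ, n = (m : ℕ∞) ∧
    ∀ (Y : C) (j : ℕ), m < j → Subsingleton (Abelian.Ext Y X j)}

end Defs

section ShortExactSequences

variable {C : Type u} [Category.{v} C] [Abelian C]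

/-- The cokernel of a morphism of short exact sequences is short exact if the morphism is mono
on the third terms. -/
lemma shortExact_cokernel {S T : ShortComplex C} (hS : S.ShortExact) (hT : T.ShortExact)
    (φ : S ⟶ T) [Mono φ.τ₃] : (cokernel φ).ShortExact := by
  let D : ShortComplex.SnakeInput C :=
    { L₀ := kernel φ
      L₁ := S
      L₂ := T
      L₃ := cokernel φ
      v₀₁ := kernel.ι φ
      v₁₂ := φ
      v₂₃ := cokernel.π φ
      w₀₂ := by simp
      w₁₃ := by simp
      h₀ := kernelIsKernel φ
      h₃ := cokernelIsCokernel φ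
      L₁_exact := hS.exact
      epi_L₁_g := hS.epi_g
      L₂_exact := hT.exact
      mono_L₂_f := hT.mono_f }
  have hδ : D.δ = 0 := by
    have h : D.v₀₁.τ₃ = 0 := by
      have : Mono D.v₁₂.τ₃ := ‹Mono φ.τ₃›
      rw [← cancel_mono D.v₁₂.τ₃, D.w₀₂_τ₃, zero_comp]
    have : Mono D.v₀₁.τ₃ := D.mono_v₀₁_τ₃
    have hid : 𝟙 D.L₀.X₃ = 0 := by rw [← cancel_mono D.v₀₁.τ₃, h, comp_zero, comp_zero]
    rw [← Category.id_comp D.δ, hid, zero_comp]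
  have : Epi D.L₂.g := hT.epi_g
  exact { exact := D.L₃_exact
          mono_f := D.L₂'_exact.mono_g hδ
          epi_g := D.epi_L₃_g }

lemma isSES_cokernel_π {X Y : C} (f : X ⟶ Y) [Mono f] : IsSES f (cokernel.π f) :=
  ⟨cokernel.condition f,
    { exact := ShortComplex.exact_of_g_is_cokernel _ (cokernelIsCokernel f) }⟩

lemma IsSES.mono {X Y Z : C} {f : X ⟶ Y} {g : Y ⟶ Z} (h : IsSES f g) : Mono f :=
  h.choose_spec.mono_f

lemma IsSES.nonempty_iso_cokernel {X Y Z : C} {f : X ⟶ Y} {g : Y ⟶ Z} (h : IsSES f g) :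
    Nonempty (cokernel f ≅ Z) :=
  ⟨(cokernelIsCokernel f).coconePointUniqueUpToIso h.choose_spec.gIsCokernel⟩

/-- The sequence `0 → coker f → coker (f ≫ g) → coker g → 0` is exact when `g` is mono. -/
lemma isSES_cokernel_map_comp {X Y Z : C} (f : X ⟶ Y) (g : Y ⟶ Z) [Mono g] :
    IsSES (cokernel.map f (f ≫ g) (𝟙 _) g (by simp))
      (cokernel.map (f ≫ g) g f (𝟙 _) (by simp)) := by
  have h2 := (kernelCokernelCompSequence_exact f g).exact 2
  have h3 := (kernelCokernelCompSequence_exact f g).exact 3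
  have hδ : kernelCokernelCompSequence.δ f g = 0 := by
    rw [kernelCokernelCompSequence.δ_fac, kernel.ι_of_mono, zero_comp, neg_zero]
  refine ⟨_, { exact := h3, mono_f := h2.mono_g hδ, epi_g := ?_ }⟩
  exact inferInstanceAs (Epi ((kernelCokernelCompSequence f g).map' 4 5))

/-- For a retract `X` of `Y` and a monomorphism `j` out of `Y`, the cokernel of the restriction
of `j` to `X` becomes, after adding `X`, an extension of the cokernel of `j` by `Y`. -/
lemma isSES_retract {X Y Z : C} (s : X ⟶ Y) (r : Y ⟶ X) (hr : s ≫ r = 𝟙 X) (j : Y ⟶ Z) [Mono j] :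
    ∃ (f : Y ⟶ cokernel (s ≫ j) ⊞ X) (g : cokernel (s ≫ j) ⊞ X ⟶ cokernel j), IsSES f g := by
  obtain ⟨w, hS⟩ := isSES_cokernel_map_comp s j
  have hm := hS.mono_f
  have he := hS.epi_g
  dsimp at hm he
  have : IsSplitMono s := ⟨⟨r, hr⟩⟩
  have hs : (ShortComplex.mk s (cokernel.π s) (by simp)).Exact :=
    ShortComplex.exact_of_g_is_cokernel _ (cokernelIsCokernel s)
  generalize hf' : cokernel.map s (s ≫ j) (𝟙 _) j (by simp) = f' at *
  generalize hg' : cokernel.map (s ≫ j) j s (𝟙 _) (by simp) = g' at *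
  have hw : biprod.lift (cokernel.π s ≫ f') r ≫ biprod.desc g' 0 = 0 := by simp [w]
  have hmono : Mono (biprod.lift (cokernel.π s ≫ f') r) := by
    refine Preadditive.mono_of_cancel_zero _ fun {T} u hu => ?_
    have h1 := hu =≫ biprod.fst
    have h2 := hu =≫ biprod.snd
    simp only [Category.assoc, biprod.lift_fst, biprod.lift_snd, zero_comp] at h1 h2
    rw [← Category.assoc, ← zero_comp (f := f'), cancel_mono] at h1
    rw [← hs.lift_f u h1] at h2 ⊢
    dsimp at h2 ⊢
    rw [Category.assoc, hr, Category.comp_id] at h2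
    rw [h2, zero_comp]
  have hepi : Epi (biprod.desc g' (0 : X ⟶ _)) := by
    have : Epi (biprod.inl ≫ biprod.desc g' (0 : X ⟶ _)) := by simpa using he
    exact epi_of_epi biprod.inl _
  refine ⟨_, _, hw, { exact := ?_, mono_f := hmono, epi_g := hepi }⟩
  apply ShortComplex.exact_of_g_is_cokernel
  have key : ∀ {T : C} (k : cokernel (s ≫ j) ⊞ X ⟶ T),
      biprod.lift (cokernel.π s ≫ f') r ≫ k = 0 →
        biprod.inr ≫ k = 0 ∧ f' ≫ biprod.inl ≫ k = 0 := by
    intro T k hk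
    have hk' : cokernel.π s ≫ f' ≫ biprod.inl ≫ k + r ≫ biprod.inr ≫ k = 0 := by
      rw [← hk, biprod.lift_eq]
      simp
    have h1 : biprod.inr ≫ k = 0 := by
      have := s ≫= hk'
      simpa [reassoc_of% hr] using this
    refine ⟨h1, ?_⟩
    rwa [h1, comp_zero, add_zero, ← comp_zero, cancel_epi] at hk'
  refine CokernelCofork.IsColimit.ofπ _ _
    (fun k hk => hS.exact.desc (biprod.inl ≫ k) (key k hk).2)
    (fun k hk => ?_) (fun k hk m hm => ?_)
  · refine biprod.hom_ext' _ _ ?_ ?_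
    · simpa using hS.exact.g_desc (biprod.inl ≫ k) (key k hk).2
    · simpa using (key k hk).1.symm
  · rw [← cancel_epi (biprod.desc g' (0 : X ⟶ _)), hm]
    refine biprod.hom_ext' _ _ ?_ ?_
    · simpa using (hS.exact.g_desc (biprod.inl ≫ k) (key k hk).2).symm
    · simpa using (key k hk).1

end ShortExactSequences

section ExtVanishing

open Abelian

variable {C : Type u} [Category.{v} C] [Abelian C] [HasExt.{w} C]

/-- `Ext^n(X, Q) = 0` for every projective `Q` and every `n > 0`. -/
def ExtProjVanishing (X : C) : Prop :=
  ∀ (Q : C), Projective Q → ∀ (n : ℕ) (x : Ext X Q (n + 1)), x = 0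

namespace ExtProjVanishing

lemma of_projective (P : C) [Projective P] : ExtProjVanishing P :=
  fun _ _ _ x => x.eq_zero_of_projective

lemma of_retract {X Y : C} (s : X ⟶ Y) (r : Y ⟶ X) (h : s ≫ r = 𝟙 X)
    (hY : ExtProjVanishing Y) : ExtProjVanishing X := by
  intro Q hQ n x
  have hx : (Ext.mk₀ s).comp ((Ext.mk₀ r).comp x (zero_add _)) (zero_add _) = x := by
    rw [Ext.mk₀_comp_mk₀_assoc, h, Ext.mk₀_id_comp]
  rw [← hx, hY Q hQ n ((Ext.mk₀ r).comp x (zero_add _)), Ext.comp_zero]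

variable {S : ShortComplex C} (hS : S.ShortExact)

include hS

lemma X₁_of_shortExact (h₂ : ExtProjVanishing S.X₂) (h₃ : ExtProjVanishing S.X₃) :
    ExtProjVanishing S.X₁ := by
  intro Q hQ n x
  obtain ⟨y, rfl⟩ := Ext.contravariant_sequence_exact₁ hS _ x (add_comm 1 (n + 1)) (h₃ Q hQ _ _)
  rw [h₂ Q hQ n y, Ext.comp_zero]

lemma X₂_of_shortExact (h₁ : ExtProjVanishing S.X₁) (h₃ : ExtProjVanishing S.X₃) :
    ExtProjVanishing S.X₂ := by
  intro Q hQ n x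
  obtain ⟨y, rfl⟩ := Ext.contravariant_sequence_exact₂ hS _ x (h₁ Q hQ _ _)
  rw [h₃ Q hQ n y, Ext.comp_zero]

lemma exists_extension (h₃ : ExtProjVanishing S.X₃) {Q : C} (hQ : Projective Q) (a : S.X₁ ⟶ Q) :
    ∃ b : S.X₂ ⟶ Q, S.f ≫ b = a := by
  obtain ⟨y, hy⟩ := Ext.contravariant_sequence_exact₁ hS _ (Ext.mk₀ a) (add_zero 1) (h₃ Q hQ 0 _)
  obtain ⟨b, rfl⟩ := (Ext.mk₀_bijective _ _).2 y
  exact ⟨b, (Ext.mk₀_bijective _ _).1 (by rw [← hy, Ext.mk₀_comp_mk₀])⟩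

end ExtProjVanishing

end ExtVanishing

section TotallyAcyclic

variable {C : Type u} [Category.{v} C] [Abelian C]

/-- Chaining one-step extensions to the right and to the left into a sequence indexed by `ℤ`. -/
lemma exists_int_chain {α : Type*} {r : α → α → Prop} {p q : α → Prop} (hqp : ∀ a, q a → p a)
    (next : ∀ a, p a → ∃ b, p b ∧ r a b) (prev : ∀ a, q a → ∃ b, q b ∧ r b a) {a : α} (ha : q a) :
    ∃ f : ℤ → α, f 0 = a ∧ (∀ i, p (f i)) ∧ ∀ i, r (f i) (f (i + 1)) := by
  choose nx hnx hrn using next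
  choose pv hpv hrp using prev
  let u : ℕ → {a // p a} := fun n =>
    Nat.rec ⟨a, hqp a ha⟩ (fun _ b => ⟨nx b.1 b.2, hnx b.1 b.2⟩) n
  let d : ℕ → {a // q a} := fun n =>
    Nat.rec ⟨a, ha⟩ (fun _ b => ⟨pv b.1 b.2, hpv b.1 b.2⟩) n
  refine ⟨fun i => Int.casesOn i (fun n => (u n).1) (fun n => (d (n + 1)).1), rfl, ?_, ?_⟩
  · rintro (n | n)
    exacts [(u n).2, hqp _ (d (n + 1)).2]
  · rintro (n | _ | n)
    exacts [hrn _ (u n).2, hrp _ ha, hrp _ (d (n + 1)).2]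

/-- The short exact sequences `0 → Zᵢ₊₁ → Pᵢ → Zᵢ → 0` with `Pᵢ` projective and
`Extⁿ(Zᵢ, Q) = 0` for `Q` projective and `n > 0` splice to a totally acyclic complex. -/
lemma isGorensteinProjective_of_shortExact [HasExt.{w} C] (S : ℤ → ShortComplex C)
    (hS : ∀ i, (S i).ShortExact) (hproj : ∀ i, Projective (S i).X₂)
    (hext : ∀ i, ExtProjVanishing (S i).X₃) (e : ∀ i, (S (i + 1)).X₃ ≅ (S i).X₁) :
    IsGorensteinProjective (S 0).X₃ := by
  have := fun i => (hS i).mono_f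
  have := fun i => (hS i).epi_g
  let D : ∀ i, (S (i + 1)).X₂ ⟶ (S i).X₂ := fun i => (S (i + 1)).g ≫ (e i).hom ≫ (S i).f
  have hD : ∀ i, D (i + 1) ≫ D i = 0 := by simp [D]
  have exact_D_g : ∀ i, (ShortComplex.mk (D i) (S i).g (by simp [D])).Exact := by
    intro i
    let φ : ShortComplex.mk (D i) (S i).g (by simp [D]) ⟶ S i :=
      { τ₁ := (S (i + 1)).g ≫ (e i).hom
        τ₂ := 𝟙 _
        τ₃ := 𝟙 _ }
    have : Epi φ.τ₁ := epi_comp _ _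
    have : IsIso φ.τ₂ := inferInstanceAs (IsIso (𝟙 _))
    have : Mono φ.τ₃ := inferInstanceAs (Mono (𝟙 _))
    exact (ShortComplex.exact_iff_of_epi_of_isIso_of_mono φ).2 (hS i).exact
  have exact_D_D : ∀ i, (ShortComplex.mk (D (i + 1)) (D i) (hD i)).Exact := by
    intro i
    let φ : ShortComplex.mk (D (i + 1)) (S (i + 1)).g (by simp [D]) ⟶
        ShortComplex.mk (D (i + 1)) (D i) (hD i) :=
      { τ₁ := 𝟙 _
        τ₂ := 𝟙 _
        τ₃ := (e i).hom ≫ (S i).f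
        comm₂₃ := by simp [D] }
    have : Epi φ.τ₁ := inferInstanceAs (Epi (𝟙 _))
    have : IsIso φ.τ₂ := inferInstanceAs (IsIso (𝟙 _))
    have : Mono φ.τ₃ := mono_comp _ _
    exact (ShortComplex.exact_iff_of_epi_of_isIso_of_mono φ).1 (exact_D_g (i + 1))
  let P : ChainComplex C ℤ := ChainComplex.of (fun i => (S i).X₂) D hD
  have hPd : ∀ i, P.d (i + 1) i = D i := ChainComplex.of_d (fun i => (S i).X₂) D
  refine ⟨P, ⟨hproj, fun i => ?_, fun Q hQ i a ha => ?_⟩, ?_⟩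
  · obtain ⟨j, rfl⟩ : ∃ j, i = j + 1 := ⟨i - 1, by simp⟩
    rw [P.exactAt_iff' (j + 1 + 1) (j + 1) j (by simp) (by simp)]
    have : P.sc' (j + 1 + 1) (j + 1) j =
        ShortComplex.mk (D (j + 1)) (D j) (hD j) := by
      simp [HomologicalComplex.sc', HomologicalComplex.shortComplexFunctor', P]
    rw [this]
    exact exact_D_D j
  · obtain ⟨j, hj⟩ : ∃ j, j = i - 1 := ⟨_, rfl⟩
    rw [← hj]
    obtain rfl : i = j + 1 := by lia
    rw [hPd] at ha ⊢
    obtain ⟨b, hb⟩ := (hext j).exists_extension (hS j) hQ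
      ((e j).inv ≫ (exact_D_g (j + 1)).desc a ha)
    refine ⟨b, ?_⟩
    change ((S (j + 1)).g ≫ (e j).hom ≫ (S j).f) ≫ b = a
    rw [Category.assoc, Category.assoc, hb, Iso.hom_inv_id_assoc]
    exact (exact_D_g (j + 1)).g_desc a ha
  · have h : P.d 1 0 = D 0 := hPd 0
    exact ⟨(exact_D_g 0).gIsCokernel.coconePointUniqueUpToIso (cokernelIsCokernel (D 0)) ≪≫
      cokernelIsoOfEq h.symm⟩

/-- The object `X` embeds in a projective object with cokernel satisfying `W`. -/
def HasProjectiveEmbedding (W : C → Prop) (X : C) : Prop :=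
  ∃ (P X' : C) (i : X ⟶ P) (p : P ⟶ X'), Projective P ∧ IsSES i p ∧ W X'

lemma HasProjectiveEmbedding.mono {W W' : C → Prop} (h : ∀ X, W X → W' X) {X : C}
    (hX : HasProjectiveEmbedding W X) : HasProjectiveEmbedding W' X := by
  obtain ⟨P, X', i, p, hP, hip, hX'⟩ := hX
  exact ⟨P, X', i, p, hP, hip, h _ hX'⟩

lemma HasProjectiveEmbedding.of_mono {W : C → Prop} {X P : C} [Projective P] (i : X ⟶ P) [Mono i]
    (h : W (cokernel i)) : HasProjectiveEmbedding W X :=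
  ⟨P, _, i, _, ‹_›, isSES_cokernel_π i, h⟩

/-- Coinduction principle for Gorenstein projective objects. -/
lemma isGorensteinProjective_of_coinductive [EnoughProjectives C] [HasExt.{w} C] (W : C → Prop)
    (hext : ∀ X, W X → ExtProjVanishing X) (hemb : ∀ X, W X → HasProjectiveEmbedding W X)
    {X : C} (hX : W X) : IsGorensteinProjective X := by
  have cover (Z : C) : (ShortComplex.mk _ _ (kernel.condition (Projective.π Z))).ShortExact :=
    { exact := ShortComplex.exact_of_f_is_kernel _ (kernelIsKernel _) }
  obtain ⟨S, h0, hS, e⟩ := exists_int_chain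
    (r := fun S T : ShortComplex C => Nonempty (T.X₃ ≅ S.X₁))
    (p := fun S => S.ShortExact ∧ Projective S.X₂ ∧ ExtProjVanishing S.X₃)
    (q := fun S => S.ShortExact ∧ Projective S.X₂ ∧ W S.X₃)
    (a := ShortComplex.mk _ _ (kernel.condition (Projective.π X)))
    (fun S hS => ⟨hS.1, hS.2.1, hext _ hS.2.2⟩)
    (fun S ⟨hS, hP, hE⟩ => ⟨_, ⟨cover S.X₁, inferInstanceAs (Projective (Projective.over _)),
      .X₁_of_shortExact hS (.of_projective _) hE⟩, ⟨Iso.refl _⟩⟩)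
    (fun S ⟨_, _, hW⟩ => by
      obtain ⟨P, X', i, p, hP, ⟨w, hip⟩, hX'⟩ := hemb _ hW
      exact ⟨ShortComplex.mk i p w, ⟨hip, hP, hX'⟩, ⟨Iso.refl _⟩⟩)
    ⟨cover X, inferInstanceAs (Projective (Projective.over _)), hX⟩
  have h := isGorensteinProjective_of_shortExact S (fun i => (hS i).1) (fun i => (hS i).2.1)
    (fun i => (hS i).2.2) (fun i => (e i).some)
  rwa [h0] at h

end TotallyAcyclic

section GorensteinProjective

variable {C : Type u} [Category.{v} C] [Abelian C]

namespace IsTotallyAcyclic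

variable {P : ChainComplex C ℤ} (hP : IsTotallyAcyclic P)

include hP

lemma shortExact (i : ℤ) :
    (ShortComplex.mk (cokernel.desc (P.d (i + 1 + 1) (i + 1)) (P.d (i + 1) i) (by simp))
      (cokernel.π (P.d (i + 1) i)) (by simp [← cancel_epi (cokernel.π _)])).ShortExact := by
  have hacyc := hP.acyclic (i + 1)
  rw [P.exactAt_iff' (i + 1 + 1) (i + 1) i (by simp) (by simp)] at hacyc
  have hm : Mono (cokernel.desc (P.d (i + 1 + 1) (i + 1)) (P.d (i + 1) i) (by simp)) :=
    hacyc.mono_cokernelDesc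
  refine { exact := ?_, mono_f := hm }
  let φ : ShortComplex.mk (P.d (i + 1) i) (cokernel.π (P.d (i + 1) i)) (by simp) ⟶
      ShortComplex.mk (cokernel.desc (P.d (i + 1 + 1) (i + 1)) (P.d (i + 1) i) (by simp))
        (cokernel.π (P.d (i + 1) i)) (by simp [← cancel_epi (cokernel.π _)]) :=
    { τ₁ := cokernel.π _
      τ₂ := 𝟙 _
      τ₃ := 𝟙 _ }
  have : Epi φ.τ₁ := inferInstanceAs (Epi (cokernel.π _))
  have : IsIso φ.τ₂ := inferInstanceAs (IsIso (𝟙 _))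
  have : Mono φ.τ₃ := inferInstanceAs (Mono (𝟙 _))
  exact (ShortComplex.exact_iff_of_epi_of_isIso_of_mono φ).1
    (ShortComplex.exact_of_g_is_cokernel _ (cokernelIsCokernel _))

open Abelian in
lemma extProjVanishing [HasExt.{w} C] (i : ℤ) :
    ExtProjVanishing (cokernel (P.d (i + 1) i)) := by
  intro Q hQ n
  induction n generalizing i with
  | zero =>
    intro x
    have := hP.projective i
    obtain ⟨y, rfl⟩ := Ext.contravariant_sequence_exact₃ (hP.shortExact i) _ x
      (Ext.eq_zero_of_projective _) (add_zero 1)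
    obtain ⟨a, rfl⟩ := (Ext.mk₀_bijective _ _).2 y
    obtain ⟨b, hb⟩ : ∃ b : P.X i ⟶ Q,
        cokernel.desc (P.d (i + 1 + 1) (i + 1)) (P.d (i + 1) i) (by simp) ≫ b = a := by
      have h := hP.homExact Q hQ (i + 1) (cokernel.π _ ≫ a) (by simp)
      rw [add_sub_cancel_right] at h
      obtain ⟨b, hb⟩ := h
      exact ⟨b, by simpa [← cancel_epi (cokernel.π _)] using hb⟩
    rw [← hb, ← Ext.mk₀_comp_mk₀]
    exact (hP.shortExact i).extClass_comp_assoc _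
  | succ n ih =>
    intro x
    have := hP.projective i
    obtain ⟨y, rfl⟩ := Ext.contravariant_sequence_exact₃ (hP.shortExact i) _ x
      (Ext.eq_zero_of_projective _) (add_comm 1 (n + 1))
    rw [ih _ y, Ext.comp_zero]

end IsTotallyAcyclic

/-- A syzygy, in any degree, of a totally acyclic complex. -/
def IsTotallyAcyclicSyzygy (X : C) : Prop :=
  ∃ P : ChainComplex C ℤ, IsTotallyAcyclic P ∧ ∃ i : ℤ, Nonempty (X ≅ cokernel (P.d (i + 1) i))

namespace IsTotallyAcyclicSyzygy

lemma extProjVanishing [HasExt.{w} C] {X : C} (hX : IsTotallyAcyclicSyzygy X) :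
    ExtProjVanishing X := by
  obtain ⟨P, hP, i, ⟨e⟩⟩ := hX
  exact .of_retract e.hom e.inv e.hom_inv_id (hP.extProjVanishing i)

lemma hasProjectiveEmbedding {X : C} (hX : IsTotallyAcyclicSyzygy X) :
    HasProjectiveEmbedding IsTotallyAcyclicSyzygy X := by
  obtain ⟨P, hP, i, ⟨e⟩⟩ := hX
  obtain ⟨j, rfl⟩ : ∃ j, i = j + 1 := ⟨i - 1, by simp⟩
  have hm := (hP.shortExact j).mono_f
  have := hP.projective j
  dsimp at hm
  refine .of_mono (e.hom ≫ cokernel.desc _ _ (P.d_comp_d (j + 1 + 1) (j + 1) j))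
    ⟨P, hP, j, ⟨cokernelEpiComp _ _ ≪≫ ?_⟩⟩
  exact (cokernelIsCokernel _).coconePointUniqueUpToIso (hP.shortExact j).gIsCokernel

end IsTotallyAcyclicSyzygy

namespace IsGorensteinProjective

lemma of_iso {X Y : C} (e : X ≅ Y) (hX : IsGorensteinProjective X) :
    IsGorensteinProjective Y := by
  obtain ⟨P, hP, ⟨e'⟩⟩ := hX
  exact ⟨P, hP, ⟨e.symm ≪≫ e'⟩⟩

lemma isTotallyAcyclicSyzygy {X : C} (hX : IsGorensteinProjective X) :
    IsTotallyAcyclicSyzygy X := by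
  obtain ⟨P, hP, e⟩ := hX
  exact ⟨P, hP, 0, e⟩

lemma extProjVanishing [HasExt.{w} C] {X : C} (hX : IsGorensteinProjective X) :
    ExtProjVanishing X :=
  hX.isTotallyAcyclicSyzygy.extProjVanishing

variable [EnoughProjectives C]

lemma hasProjectiveEmbedding {X : C} (hX : IsGorensteinProjective X) :
    HasProjectiveEmbedding IsGorensteinProjective X := by
  have := hasExt_of_enoughProjectives.{v} C
  exact hX.isTotallyAcyclicSyzygy.hasProjectiveEmbedding.mono fun _ hY =>
    isGorensteinProjective_of_coinductive IsTotallyAcyclicSyzygy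
      (fun _ h => h.extProjVanishing) (fun _ h => h.hasProjectiveEmbedding) hY

lemma exists_mono {X : C} (hX : IsGorensteinProjective X) :
    ∃ (P : C) (i : X ⟶ P), Projective P ∧ Mono i ∧ IsGorensteinProjective (cokernel i) := by
  obtain ⟨P, X', i, p, hP, hip, hX'⟩ := hX.hasProjectiveEmbedding
  exact ⟨P, i, hP, hip.mono, hX'.of_iso hip.nonempty_iso_cokernel.some.symm⟩

lemma of_mono [HasExt.{w} C] {X P : C} (hX : ExtProjVanishing X) [Projective P] (i : X ⟶ P)
    [Mono i] (hi : IsGorensteinProjective (cokernel i)) : IsGorensteinProjective X := by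
  refine isGorensteinProjective_of_coinductive
    (fun Y => ExtProjVanishing Y ∧ HasProjectiveEmbedding IsGorensteinProjective Y)
    (fun _ h => h.1) (fun _ h => h.2.mono fun _ hY => ⟨hY.extProjVanishing, ?_⟩)
    ⟨hX, .of_mono i hi⟩
  exact hY.hasProjectiveEmbedding

lemma of_projective (P : C) [Projective P] : IsGorensteinProjective P := by
  have := hasExt_of_enoughProjectives.{v} C
  refine isGorensteinProjective_of_coinductive Projective (fun Q _ => .of_projective Q)
    (fun Q _ => .of_mono (𝟙 Q) ?_) ‹_›
  exact (Projective.zero_projective).of_iso (cokernel.ofEpi (𝟙 Q)).symm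

/-- Gorenstein projective objects are closed under extensions. -/
lemma X₂_of_isSES {X Y Z : C} {f : X ⟶ Y} {g : Y ⟶ Z} (h : IsSES f g)
    (hX : IsGorensteinProjective X) (hZ : IsGorensteinProjective Z) :
    IsGorensteinProjective Y := by
  have := hasExt_of_enoughProjectives.{v} C
  refine isGorensteinProjective_of_coinductive
    (fun Y => ∃ (X Z : C) (f : X ⟶ Y) (g : Y ⟶ Z), IsSES f g ∧
      IsGorensteinProjective X ∧ IsGorensteinProjective Z) ?_ ?_ ⟨X, Z, f, g, h, hX, hZ⟩
  · rintro Y ⟨X, Z, f, g, ⟨w, hS⟩, hX, hZ⟩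
    exact .X₂_of_shortExact hS hX.extProjVanishing hZ.extProjVanishing
  · rintro Y ⟨X, Z, f, g, ⟨w, hS⟩, hX, hZ⟩
    obtain ⟨P, i, hP, hi, hX'⟩ := hX.exists_mono
    obtain ⟨Q, j, hQ, hj, hZ'⟩ := hZ.exists_mono
    obtain ⟨k, hk⟩ := hZ.extProjVanishing.exists_extension hS hP i
    dsimp at k hk
    let φ : ShortComplex.mk f g w ⟶ ShortComplex.mk (biprod.inl : P ⟶ P ⊞ Q) biprod.snd (by simp) :=
      { τ₁ := i
        τ₂ := biprod.lift k (g ≫ j)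
        τ₃ := j
        comm₁₂ := by ext <;> simp [hk, reassoc_of% w] }
    have : Mono φ.τ₁ := hi
    have : Mono φ.τ₃ := hj
    have hT := (ShortComplex.Splitting.ofHasBinaryBiproduct P Q).shortExact
    have := hS.mono_f
    have := hT.mono_f
    have hm : Mono φ.τ₂ := ShortComplex.mono_τ₂_of_exact_of_mono φ hS.exact
    have hc := shortExact_cokernel hS hT φ
    have e₁ : (cokernel φ).X₁ ≅ cokernel i :=
      PreservesCokernel.iso ShortComplex.π₁ φ
    have e₃ : (cokernel φ).X₃ ≅ cokernel j :=
      PreservesCokernel.iso ShortComplex.π₃ φ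
    have w₂ : φ.τ₂ ≫ (cokernel.π φ).τ₂ = 0 := by
      rw [← ShortComplex.comp_τ₂, cokernel.condition, ShortComplex.zero_τ₂]
    have hcol := isColimitCoforkMapOfIsColimit' ShortComplex.π₂ (cokernel.condition φ)
      (cokernelIsCokernel φ)
    exact ⟨P ⊞ Q, (cokernel φ).X₂, φ.τ₂, (cokernel.π φ).τ₂, inferInstance,
      ⟨w₂, { exact := ShortComplex.exact_of_g_is_cokernel _ hcol
             mono_f := hm
             epi_g := epi_of_isColimit_cofork hcol }⟩,
      (cokernel φ).X₁, (cokernel φ).X₃, _, _, ⟨_, hc⟩, hX'.of_iso e₁.symm, hZ'.of_iso e₃.symm⟩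

/-- Gorenstein projective objects are closed under kernels of epimorphisms. -/
lemma X₁_of_isSES {X Y Z : C} {f : X ⟶ Y} {g : Y ⟶ Z} (h : IsSES f g)
    (hY : IsGorensteinProjective Y) (hZ : IsGorensteinProjective Z) :
    IsGorensteinProjective X := by
  have := hasExt_of_enoughProjectives.{v} C
  obtain ⟨P, j, hP, hj, hY'⟩ := hY.exists_mono
  have := h.mono
  refine .of_mono (.X₁_of_shortExact h.choose_spec hY.extProjVanishing hZ.extProjVanishing)
    (f ≫ j) ?_
  exact X₂_of_isSES (isSES_cokernel_map_comp f j)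
    (hZ.of_iso h.nonempty_iso_cokernel.some.symm) hY'

lemma of_retract {X Y : C} (s : X ⟶ Y) (r : Y ⟶ X) (hr : s ≫ r = 𝟙 X)
    (hY : IsGorensteinProjective Y) : IsGorensteinProjective X := by
  have := hasExt_of_enoughProjectives.{v} C
  refine isGorensteinProjective_of_coinductive
    (fun X => ∃ (Y : C) (s : X ⟶ Y) (r : Y ⟶ X), s ≫ r = 𝟙 X ∧ IsGorensteinProjective Y)
    ?_ ?_ ⟨Y, s, r, hr, hY⟩
  · rintro X ⟨Y, s, r, hr, hY⟩
    exact .of_retract s r hr hY.extProjVanishing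
  · rintro X ⟨Y, s, r, hr, hY⟩
    obtain ⟨P, j, hP, hj, hY'⟩ := hY.exists_mono
    have : IsSplitMono s := ⟨⟨r, hr⟩⟩
    obtain ⟨f, g, hfg⟩ := isSES_retract s r hr j
    exact .of_mono (s ≫ j) ⟨_, biprod.inl, biprod.fst, by simp, X₂_of_isSES hfg hY hY'⟩

end IsGorensteinProjective

end GorensteinProjective

/-- The Gorenstein projective objects form a projectively resolving
subcategory. -/
theorem gp_projectively_resolving {C : Type u} [Category.{v} C] [Abelian C]
    [EnoughProjectives C] :
    (∀ P : C, Projective P → IsGorensteinProjective P) ∧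
    (∀ (X Y : C), IsGorensteinProjective Y →
      (∃ (s : X ⟶ Y) (r : Y ⟶ X), s ≫ r = 𝟙 X) → IsGorensteinProjective X) ∧
    (∀ (X Y Z : C) (f : X ⟶ Y) (g : Y ⟶ Z), IsSES f g →
      IsGorensteinProjective Z →
      (IsGorensteinProjective X ↔ IsGorensteinProjective Y)) := by
  refine ⟨fun P _ => .of_projective P, ?_, ?_⟩
  · rintro X Y hY ⟨s, r, hr⟩
    exact .of_retract s r hr hY
  · exact fun X Y Z f g h hZ => ⟨fun hX => .X₂_of_isSES h hX hZ, fun hY => .X₁_of_isSES h hY hZ⟩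
end

section
/- Let C be an abelian category with enough projectives. For any object X of finite G-dimension n, there exists a short exact sequence 0→K→G→X→0 with G Gorenstein projective and K of finite projective dimension (equal to n−1 when n>0). In particular G→X is a special right gpC-approximation. -/
open CategoryTheory CategoryTheory.Limits

universe w w' v v' u u'

section Helpers

open ZeroObject

variable {C : Type u} [Category.{v} C] [Abelian C]

namespace IsSES

variable {X Y Z : C} {f : X ⟶ Y} {g : Y ⟶ Z}

lemma mono_s10 (h : IsSES f g) : Mono f := h.choose_spec.mono_f

lemma epi (h : IsSES f g) : Epi g := h.choose_spec.epi_g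

lemma comp_eq_zero (h : IsSES f g) : f ≫ g = 0 := h.choose

lemma exists_lift (h : IsSES f g) {T : C} (t : T ⟶ Y) (ht : t ≫ g = 0) :
    ∃ l : T ⟶ X, l ≫ f = t :=
  have := h.mono_s10
  ⟨h.choose_spec.exact.lift t ht, h.choose_spec.exact.lift_f t ht⟩

lemma exists_desc (h : IsSES f g) {T : C} (t : Y ⟶ T) (ht : f ≫ t = 0) :
    ∃ l : Z ⟶ T, g ≫ l = t :=
  have := h.epi
  h.choose_spec.exact.desc' t ht

/-- A monomorphism followed by its cokernel is a short exact sequence. -/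
lemma of_exists_desc (hf : Mono f) (hg : Epi g) (w : f ≫ g = 0)
    (hdesc : ∀ {T : C} (t : Y ⟶ T), f ≫ t = 0 → ∃ l : Z ⟶ T, g ≫ l = t) : IsSES f g := by
  choose l hl using @hdesc
  refine ⟨w, { exact := ShortComplex.exact_of_g_is_cokernel _ ?_, mono_f := hf, epi_g := hg }⟩
  exact CokernelCofork.IsColimit.ofπ g w (fun t ht => l t ht) (fun t ht => hl t ht)
    (fun t ht m hm => by rw [← cancel_epi g, hm, hl])

lemma kernel_of_epi (g : Y ⟶ Z) [Epi g] : IsSES (kernel.ι g) g :=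
  ⟨kernel.condition g, { exact := ShortComplex.exact_kernel g }⟩

lemma zero_id (X : C) : IsSES (0 : (0 : C) ⟶ X) (𝟙 X) :=
  of_exists_desc ⟨fun _ _ _ => (isZero_zero C).eq_of_tgt _ _⟩ inferInstance (by simp)
    (fun t _ => ⟨t, by simp⟩)

lemma id_zero (X : C) : IsSES (𝟙 X) (0 : X ⟶ (0 : C)) :=
  of_exists_desc inferInstance ⟨fun _ _ _ => (isZero_zero C).eq_of_src _ _⟩ (by simp)
    (fun t ht => ⟨0, by simpa using ht.symm⟩)

lemma of_iso_right (h : IsSES f g) {Z' : C} (e : Z ≅ Z') : IsSES f (g ≫ e.hom) := by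
  have := h.epi
  refine of_exists_desc h.mono_s10 inferInstance (by simp [reassoc_of% h.comp_eq_zero]) ?_
  intro T t ht
  obtain ⟨l, hl⟩ := h.exists_desc t ht
  exact ⟨e.inv ≫ l, by simpa using hl⟩

lemma of_iso_left (h : IsSES f g) {X' : C} (e : X' ≅ X) : IsSES (e.hom ≫ f) g := by
  have := h.mono_s10
  refine of_exists_desc inferInstance h.epi (by simp [h.comp_eq_zero]) ?_
  intro T t ht
  exact h.exists_desc t (by simpa using ht)

/-- The pushout of a short exact sequence along a morphism from its first term. -/
lemma pushout_of_isPushout (h : IsSES f g) {W D : C} {k : X ⟶ W} {a : Y ⟶ D} {b : W ⟶ D}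
    (sq : IsPushout f k a b) : ∃ d : D ⟶ Z, a ≫ d = g ∧ IsSES b d := by
  have := h.mono_s10
  have hg := h.epi
  have hd : a ≫ sq.desc g 0 (by simp [h.comp_eq_zero]) = g := sq.inl_desc _ _ _
  refine ⟨_, hd, of_exists_desc ?_ ?_ (sq.inr_desc _ _ _) ?_⟩
  · exact MorphismProperty.of_isPushout (P := .monomorphisms C) sq.flip
      (MorphismProperty.monomorphisms.infer_property f)
  · rw [← hd] at hg
    exact epi_of_epi a _
  · intro T t ht
    obtain ⟨l, hl⟩ := h.exists_desc (a ≫ t) (by rw [sq.w_assoc, ht, comp_zero])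
    refine ⟨l, sq.hom_ext ?_ ?_⟩
    · rw [reassoc_of% hd, hl]
    · rw [sq.inr_desc_assoc, zero_comp, ht]

/-- The cokernels of two composable monomorphisms and of their composition form a short exact
sequence. -/
lemma exists_comp (h : IsSES f g) {P G : C} {i : Y ⟶ P} {p : P ⟶ G} (h' : IsSES i p) :
    ∃ (W : C) (c : P ⟶ W) (a : Z ⟶ W) (b : W ⟶ G), IsSES (f ≫ i) c ∧ IsSES a b := by
  have := h.mono_s10
  have := h.epi
  have := h'.mono_s10
  have sq := IsPushout.of_hasPushout i g
  obtain ⟨b, -, hb⟩ := h'.pushout_of_isPushout sq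
  refine ⟨_, pushout.inl i g, pushout.inr i g, b, of_exists_desc inferInstance ?_ ?_ ?_, hb⟩
  · exact MorphismProperty.of_isPushout (P := .epimorphisms C) sq
      (MorphismProperty.epimorphisms.infer_property g)
  · rw [Category.assoc, sq.w, reassoc_of% h.comp_eq_zero, zero_comp]
  · intro T t ht
    obtain ⟨l, hl⟩ := h.exists_desc (i ≫ t) (by simpa using ht)
    exact ⟨sq.desc t l hl.symm, sq.inl_desc _ _ _⟩

end IsSES

section Ext

variable [HasExt.{w} C] {X Y Z : C} {f : X ⟶ Y} {g : Y ⟶ Z}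

open Abelian

namespace IsSES

lemma exists_extension (h : IsSES f g) {Q : C} (hQ : Subsingleton (Ext Z Q 1)) (z : X ⟶ Q) :
    ∃ y : Y ⟶ Q, f ≫ y = z := by
  obtain ⟨x, hx⟩ := Ext.contravariant_sequence_exact₁ h.choose_spec Q (Ext.mk₀ z) (add_zero 1)
    (Subsingleton.elim _ _)
  obtain ⟨y, rfl⟩ := Ext.homEquiv₀.symm.surjective x
  refine ⟨y, Ext.homEquiv₀.symm.injective ?_⟩
  simpa using hx

lemma subsingleton_ext_one (h : IsSES f g) (hY : Projective Y) {Q : C}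
    (hQ : ∀ z : X ⟶ Q, ∃ y : Y ⟶ Q, f ≫ y = z) : Subsingleton (Ext Z Q 1) := by
  refine subsingleton_of_forall_eq 0 fun e => ?_
  obtain ⟨x, rfl⟩ := Ext.contravariant_sequence_exact₃ h.choose_spec Q e
    (Ext.eq_zero_of_projective _) (add_zero 1)
  obtain ⟨z, rfl⟩ := Ext.homEquiv₀.symm.surjective x
  obtain ⟨y, rfl⟩ := hQ z
  rw [Ext.homEquiv₀_symm_apply, ← Ext.mk₀_comp_mk₀]
  exact h.choose_spec.extClass_comp_assoc _

lemma subsingleton_ext_succ (h : IsSES f g) (hY : Projective Y) {Q : C} {n : ℕ}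
    (hX : Subsingleton (Ext X Q n)) : Subsingleton (Ext Z Q (n + 1)) := by
  refine subsingleton_of_forall_eq 0 fun e => ?_
  obtain ⟨x, rfl⟩ := Ext.contravariant_sequence_exact₃ h.choose_spec Q e
    (Ext.eq_zero_of_projective _) (add_comm 1 n)
  rw [Subsingleton.elim x 0, Ext.comp_zero]

lemma subsingleton_ext_syzygy (h : IsSES f g) (hY : Projective Y) {Q : C} {n : ℕ}
    (hZ : Subsingleton (Ext Z Q (n + 2))) : Subsingleton (Ext X Q (n + 1)) := by
  refine subsingleton_of_forall_eq 0 fun e => ?_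
  obtain ⟨x, rfl⟩ := Ext.contravariant_sequence_exact₁ h.choose_spec Q e (add_comm 1 (n + 1))
    (Subsingleton.elim _ _)
  rw [Ext.eq_zero_of_projective x, Ext.comp_zero]

lemma subsingleton_ext_middle (h : IsSES f g) {Q : C} {n : ℕ}
    (hX : Subsingleton (Ext X Q n)) (hZ : Subsingleton (Ext Z Q n)) :
    Subsingleton (Ext Y Q n) := by
  refine subsingleton_of_forall_eq 0 fun e => ?_
  obtain ⟨x, rfl⟩ := Ext.contravariant_sequence_exact₂ h.choose_spec Q e
    (Subsingleton.elim _ _)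
  rw [Subsingleton.elim x 0, Ext.comp_zero]

lemma subsingleton_ext_of_covariant (h : IsSES f g) {B : C} {n : ℕ}
    (hY : Subsingleton (Ext B Y n)) (hX : Subsingleton (Ext B X (n + 1))) :
    Subsingleton (Ext B Z n) := by
  refine subsingleton_of_forall_eq 0 fun e => ?_
  obtain ⟨x, rfl⟩ := Ext.covariant_sequence_exact₃ B h.choose_spec e rfl
    (Subsingleton.elim _ _)
  rw [Subsingleton.elim x 0, Ext.zero_comp]

end IsSES

end Ext

/-- A relation which can be continued in both directions admits a bi-infinite chain through any
point. -/
lemma exists_int_chain_s10 {T : Type*} (R : T → T → Prop) (hl : ∀ a, ∃ b, R b a)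
    (hr : ∀ a, ∃ b, R a b) (x : T) : ∃ A : ℤ → T, A 0 = x ∧ ∀ i, R (A (i + 1)) (A i) := by
  choose l hl using hl
  choose r hr using hr
  refine ⟨fun i => match i with
    | Int.ofNat n => l^[n] x
    | Int.negSucc n => r^[n + 1] x, rfl, ?_⟩
  rintro (n | n)
  · change R (l^[n + 1] x) (l^[n] x)
    rw [Function.iterate_succ_apply']
    exact hl _
  · obtain _ | n := n
    · exact hr x
    · change R (r^[n + 1] x) (r^[n + 1 + 1] x)
      rw [Function.iterate_succ_apply' r (n + 1)]
      exact hr _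

namespace IsTotallyAcyclic

variable {P : ChainComplex C ℤ}

lemma isSES_cokernel (hP : IsTotallyAcyclic P) (i : ℤ) :
    IsSES (cokernel.desc (P.d (i + 1 + 1) (i + 1)) (P.d (i + 1) i) (P.d_comp_d _ _ _))
      (cokernel.π (P.d (i + 1) i)) := by
  refine IsSES.of_exists_desc ?_ inferInstance ?_ ?_
  · have := (P.exactAt_iff' (i + 1 + 1) (i + 1) i (by simp) (by simp)).1 (hP.acyclic (i + 1))
    exact (ShortComplex.exact_iff_mono_cokernel_desc _).1 this
  · rw [← cancel_epi (cokernel.π _)]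
    simp
  · intro T t ht
    refine ⟨cokernel.desc (P.d (i + 1) i) t ?_, cokernel.π_desc _ _ _⟩
    rw [← cokernel.π_desc (P.d (i + 1 + 1) (i + 1)) (P.d (i + 1) i) (P.d_comp_d _ _ _),
      Category.assoc, ht, comp_zero]

lemma exists_extension (hP : IsTotallyAcyclic P) (i : ℤ) {Q : C} (hQ : Projective Q)
    (z : cokernel (P.d (i + 1 + 1) (i + 1)) ⟶ Q) :
    ∃ y : P.X i ⟶ Q,
      cokernel.desc (P.d (i + 1 + 1) (i + 1)) (P.d (i + 1) i) (P.d_comp_d _ _ _) ≫ y = z := by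
  have key : ∃ y : P.X (i + 1 - 1) ⟶ Q, P.d (i + 1) (i + 1 - 1) ≫ y = cokernel.π _ ≫ z :=
    hP.homExact Q hQ (i + 1) (cokernel.π _ ≫ z) (by simp)
  rw [add_sub_cancel_right] at key
  obtain ⟨y, hy⟩ := key
  exact ⟨y, by rw [← cancel_epi (cokernel.π _), cokernel.π_desc_assoc, hy]⟩

end IsTotallyAcyclic

variable [HasExt.{w} C]

/-- A class of objects without `Ext¹` into projectives and which is closed, through short exact
sequences with projective middle term, in both directions consists of Gorenstein projectives. -/
lemma isGorensteinProjective_of_closed (S : C → Prop)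
    (hext : ∀ A, S A → ∀ Q, Projective Q → Subsingleton (Abelian.Ext A Q 1))
    (hl : ∀ A, S A → ∃ (A' P : C) (f : A' ⟶ P) (g : P ⟶ A), Projective P ∧ IsSES f g ∧ S A')
    (hr : ∀ A, S A → ∃ (P A' : C) (f : A ⟶ P) (g : P ⟶ A'), Projective P ∧ IsSES f g ∧ S A')
    {X : C} (hX : S X) : IsGorensteinProjective X := by
  obtain ⟨A, hA0, hA⟩ := exists_int_chain_s10
    (fun a b : {A // S A} => ∃ (P : C) (f : a.1 ⟶ P) (g : P ⟶ b.1), Projective P ∧ IsSES f g)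
    (fun a => by
      obtain ⟨A', P, f, g, hP, h, hA'⟩ := hl a.1 a.2
      exact ⟨⟨A', hA'⟩, P, f, g, hP, h⟩)
    (fun a => by
      obtain ⟨P, A', f, g, hP, h, hA'⟩ := hr a.1 a.2
      exact ⟨⟨A', hA'⟩, P, f, g, hP, h⟩) ⟨X, hX⟩
  choose P ι p hP hs using hA
  have hw (i : ℤ) : (p (i + 1 + 1) ≫ ι (i + 1)) ≫ p (i + 1) ≫ ι i = 0 := by
    simp [reassoc_of% (hs (i + 1)).comp_eq_zero]
  let K : ChainComplex C ℤ := ChainComplex.of P (fun i => p (i + 1) ≫ ι i) hw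
  have hd (i : ℤ) : K.d (i + 1) i = p (i + 1) ≫ ι i :=
    ChainComplex.of_d P (fun i => p (i + 1) ≫ ι i) i
  refine ⟨K, ⟨hP, fun i => ?_, fun Q hQ i f hf => ?_⟩, ⟨?_⟩⟩
  · obtain ⟨i, rfl⟩ : ∃ j, i = j + 1 := ⟨i - 1, by simp⟩
    rw [K.exactAt_iff' (i + 1 + 1) (i + 1) i (by simp) (by simp),
      ShortComplex.exact_iff_exact_up_to_refinements]
    intro T (t : T ⟶ P (i + 1)) (ht : t ≫ K.d (i + 1) i = 0)
    have := (hs i).mono_s10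
    have := (hs (i + 1 + 1)).epi
    obtain ⟨l, hl⟩ := (hs (i + 1)).exists_lift t
      ((cancel_mono (ι i)).1 (by rw [Category.assoc, ← hd, zero_comp]; exact ht))
    refine ⟨pullback l (p (i + 1 + 1)), pullback.fst _ _, inferInstance, pullback.snd _ _, ?_⟩
    change _ = _ ≫ K.d (i + 1 + 1) (i + 1)
    rw [hd, ← hl]
    exact pullback.condition_assoc _
  · obtain ⟨j, hj⟩ : ∃ j, i - 1 = j := ⟨_, rfl⟩
    rw [hj]
    obtain rfl : i = j + 1 := by lia
    have := (hs (j + 1 + 1)).epi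
    rw [hd, Category.assoc] at hf
    obtain ⟨z, hz⟩ := (hs (j + 1)).exists_desc f
      ((cancel_epi (p (j + 1 + 1))).1 (by rw [hf, comp_zero]))
    obtain ⟨y, hy⟩ := (hs j).exists_extension (hext _ (A j).2 Q hQ) z
    exact ⟨y, by rw [hd, Category.assoc, hy, hz]⟩
  · have hA0' : X = (A 0).1 := by rw [hA0]
    have := (hs 0).epi
    have := (hs (0 + 1)).epi
    have hd0 : K.d 1 0 = p (0 + 1) ≫ ι 0 := hd 0
    exact eqToIso hA0' ≪≫
      ((hs 0).choose_spec.exact.gIsCokernel.coconePointUniqueUpToIso (colimit.isColimit _)) ≪≫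
      (cokernelEpiComp (p (0 + 1)) (ι 0)).symm ≪≫ cokernelIsoOfEq hd0.symm

namespace IsGorensteinProjective

/-- The basic properties of all syzygies of a totally acyclic complex. -/
lemma properties {X : C} (hX : IsGorensteinProjective X) :
    (∀ Q, Projective Q → Subsingleton (Abelian.Ext X Q 1)) ∧
    (∃ (A P : C) (f : A ⟶ P) (g : P ⟶ X),
      Projective P ∧ IsSES f g ∧ IsGorensteinProjective A) ∧
    (∃ (P A : C) (f : X ⟶ P) (g : P ⟶ A),
      Projective P ∧ IsSES f g ∧ IsGorensteinProjective A) := by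
  let S (A : C) : Prop := ∃ P : ChainComplex C ℤ, IsTotallyAcyclic P ∧
    ∃ i : ℤ, Nonempty (A ≅ cokernel (P.d (i + 1) i))
  have hext (A : C) (hA : S A) (Q : C) (hQ : Projective Q) :
      Subsingleton (Abelian.Ext A Q 1) := by
    obtain ⟨P, hP, i, ⟨e⟩⟩ := hA
    exact ((hP.isSES_cokernel i).of_iso_right e.symm).subsingleton_ext_one (hP.projective i)
      (hP.exists_extension i hQ)
  have hl (A : C) (hA : S A) : ∃ (A' P : C) (f : A' ⟶ P) (g : P ⟶ A),
      Projective P ∧ IsSES f g ∧ S A' := by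
    obtain ⟨P, hP, i, ⟨e⟩⟩ := hA
    exact ⟨_, _, _, _, hP.projective i, (hP.isSES_cokernel i).of_iso_right e.symm,
      P, hP, i + 1, ⟨Iso.refl _⟩⟩
  have hr (A : C) (hA : S A) : ∃ (P A' : C) (f : A ⟶ P) (g : P ⟶ A'),
      Projective P ∧ IsSES f g ∧ S A' := by
    obtain ⟨P, hP, i, ⟨e⟩⟩ := hA
    obtain ⟨i, rfl⟩ : ∃ j, i = j + 1 := ⟨i - 1, by simp⟩
    exact ⟨_, _, _, _, hP.projective i, (hP.isSES_cokernel i).of_iso_left e,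
      P, hP, i, ⟨Iso.refl _⟩⟩
  have hGP {A : C} (hA : S A) : IsGorensteinProjective A :=
    isGorensteinProjective_of_closed S hext hl hr hA
  have hSX : S X := by
    obtain ⟨P, hP, he⟩ := hX
    exact ⟨P, hP, 0, he⟩
  refine ⟨hext X hSX, ?_, ?_⟩
  · obtain ⟨A, P, f, g, hP, h, hA⟩ := hl X hSX
    exact ⟨A, P, f, g, hP, h, hGP hA⟩
  · obtain ⟨P, A, f, g, hP, h, hA⟩ := hr X hSX
    exact ⟨P, A, f, g, hP, h, hGP hA⟩

lemma subsingleton_ext {X : C} (hX : IsGorensteinProjective X) {Q : C} (hQ : Projective Q)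
    (n : ℕ) : Subsingleton (Abelian.Ext X Q (n + 1)) := by
  induction n generalizing X with
  | zero => exact hX.properties.1 Q hQ
  | succ n ih =>
    obtain ⟨A, P, f, g, hP, h, hA⟩ := hX.properties.2.1
    exact h.subsingleton_ext_succ hP (ih hA)

end IsGorensteinProjective

/-- `A` is obtained from an object satisfying `S` by taking syzygies finitely many times. -/
inductive IsIteratedSyzygy (S : C → Prop) : C → Prop
  | of_mem {A : C} (hA : S A) : IsIteratedSyzygy S A
  | syzygy {A P B : C} (f : A ⟶ P) (g : P ⟶ B) (hP : Projective P) (h : IsSES f g)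
      (hB : IsIteratedSyzygy S B) : IsIteratedSyzygy S A

lemma projDim_le_iff (X : C) (n : ℕ) : projDim X ≤ n ↔ HasProjectiveDimensionLE X n := by
  have hiff (m : ℕ) : (∀ (Y : C) (j : ℕ), m < j → Subsingleton (Abelian.Ext X Y j)) ↔
      HasProjectiveDimensionLE X m :=
    ⟨fun h => HasProjectiveDimensionLT.mk fun i hi Y e => (h Y i hi).elim _ _,
      fun _ Y j hj => HasProjectiveDimensionLT.subsingleton X (m + 1) j hj Y⟩
  refine ⟨fun h => ?_, fun h => sInf_le ⟨n, rfl, (hiff n).2 h⟩⟩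
  have hS : {k : ℕ∞ | ∃ m : ℕ, k = m ∧
      ∀ (Y : C) (j : ℕ), m < j → Subsingleton (Abelian.Ext X Y j)}.Nonempty := by
    by_contra hS
    rw [Set.not_nonempty_iff_eq_empty] at hS
    simp [projDim, hS] at h
  obtain ⟨m, hm, hX⟩ := csInf_mem hS
  have : HasProjectiveDimensionLE X m := (hiff m).1 hX
  have hmn : m ≤ n := by exact_mod_cast hm.symm.trans_le h
  exact hasProjectiveDimensionLT_of_ge X (m + 1) (n + 1) (by lia)

variable [EnoughProjectives C]

/-- With enough projectives, Gorenstein projectivity only needs to be checked by coresolving. -/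
lemma isGorensteinProjective_of_coresolving (S : C → Prop)
    (hext : ∀ A, S A → ∀ Q, Projective Q → ∀ n, Subsingleton (Abelian.Ext A Q (n + 1)))
    (hr : ∀ A, S A → ∃ (P A' : C) (f : A ⟶ P) (g : P ⟶ A'), Projective P ∧ IsSES f g ∧ S A')
    {X : C} (hX : S X) : IsGorensteinProjective X := by
  have hext' (A : C) (hA : IsIteratedSyzygy S A) (Q : C) (hQ : Projective Q) :
      ∀ n, Subsingleton (Abelian.Ext A Q (n + 1)) := by
    induction hA with
    | of_mem hA => exact hext _ hA Q hQ
    | syzygy f g hP h _ ih => exact fun n => h.subsingleton_ext_syzygy hP (ih (n + 1))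
  refine isGorensteinProjective_of_closed (IsIteratedSyzygy S)
    (fun A hA Q hQ => hext' A hA Q hQ 0) (fun A hA => ?_) (fun A hA => ?_) (.of_mem hX)
  · exact ⟨_, _, _, _, inferInstance, IsSES.kernel_of_epi (Projective.π A),
      .syzygy _ _ inferInstance (IsSES.kernel_of_epi (Projective.π A)) hA⟩
  · cases hA with
    | of_mem hA =>
      obtain ⟨P, A', f, g, hP, h, hA'⟩ := hr A hA
      exact ⟨P, A', f, g, hP, h, .of_mem hA'⟩
    | syzygy f g hP h hB => exact ⟨_, _, f, g, hP, h, hB⟩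

lemma isGorensteinProjective_of_projective {X : C} (hX : Projective X) :
    IsGorensteinProjective X :=
  isGorensteinProjective_of_coresolving (fun A => Projective A)
    (fun _ _ _ _ _ => subsingleton_of_forall_eq 0 fun e => Abelian.Ext.eq_zero_of_projective e)
    (fun A hA => ⟨A, 0, _, _, hA, IsSES.id_zero A, inferInstance⟩) hX

lemma isGorensteinProjective_of_isSES {A E B : C} {f : A ⟶ E} {g : E ⟶ B} (h : IsSES f g)
    (hA : IsGorensteinProjective A) (hB : IsGorensteinProjective B) :
    IsGorensteinProjective E := by
  refine isGorensteinProjective_of_coresolving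
    (fun E => ∃ (A B : C) (f : A ⟶ E) (g : E ⟶ B), IsSES f g ∧
      IsGorensteinProjective A ∧ IsGorensteinProjective B) ?_ ?_ ⟨A, B, f, g, h, hA, hB⟩
  · rintro E ⟨A, B, f, g, h, hA, hB⟩ Q hQ n
    exact h.subsingleton_ext_middle (hA.subsingleton_ext hQ n) (hB.subsingleton_ext hQ n)
  · rintro E ⟨A, B, f, g, h, hA, hB⟩
    obtain ⟨P, A', i, p, hP, hi, hA'⟩ := hA.properties.2.2
    obtain ⟨Q, B', j, q, hQ, hj, hB'⟩ := hB.properties.2.2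
    have sq := IsPushout.of_hasPushout f i
    obtain ⟨d, -, hd⟩ := h.pushout_of_isPushout sq
    obtain ⟨d', -, hd'⟩ := hi.pushout_of_isPushout sq.flip
    obtain ⟨r, hr⟩ := hd.exists_extension (hB.properties.1 P hP) (𝟙 P)
    have := hd.epi
    have := hj.mono_s10
    have := hj.epi
    have hs : IsSES (biprod.lift r (d ≫ j)) (biprod.snd ≫ q : P ⊞ Q ⟶ B') := by
      refine IsSES.of_exists_desc ?_ inferInstance (by simp [hj.comp_eq_zero]) ?_
      · refine Preadditive.mono_of_cancel_zero _ fun x hx => ?_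
        have h₁ : x ≫ r = 0 := by simpa using congrArg (· ≫ biprod.fst) hx
        have h₂ : x ≫ d ≫ j = 0 := by simpa using congrArg (· ≫ biprod.snd) hx
        obtain ⟨y, rfl⟩ := hd.exists_lift x
          ((cancel_mono j).1 (by rw [Category.assoc, h₂, zero_comp]))
        rw [Category.assoc, hr, Category.comp_id] at h₁
        rw [h₁, zero_comp]
      · intro T t ht
        have ht' : r ≫ biprod.inl ≫ t + d ≫ j ≫ biprod.inr ≫ t = 0 := by
          simpa [biprod.lift_eq] using ht
        have hinl : biprod.inl ≫ t = 0 := by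
          simpa [reassoc_of% hr, reassoc_of% hd.comp_eq_zero]
            using congrArg (pushout.inr f i ≫ ·) ht'
        rw [hinl, comp_zero, zero_add] at ht'
        obtain ⟨l, hl⟩ := hj.exists_desc (biprod.inr ≫ t)
          ((cancel_epi d).1 (by rw [ht', comp_zero]))
        refine ⟨l, biprod.hom_ext' _ _ ?_ ?_⟩
        · simp [hinl]
        · simpa using hl
    obtain ⟨W, c, a, b, hc, hab⟩ := hd'.exists_comp hs
    exact ⟨_, W, _, c, inferInstance, hc, A', B', a, b, hab, hA', hB'⟩

lemma exists_isSES_of_hasResDimLE {X : C} {n : ℕ}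
    (hX : HasResDimLE IsGorensteinProjective X n) :
    ∃ (K G : C) (f : K ⟶ G) (g : G ⟶ X),
      IsSES f g ∧ IsGorensteinProjective G ∧ HasProjectiveDimensionLT K n := by
  induction hX with
  | of_mem hX n =>
    exact ⟨0, _, _, _, IsSES.zero_id _, hX, hasProjectiveDimensionLT_of_ge _ 0 n n.zero_le⟩
  | step n f g h hG _ ih =>
    obtain ⟨K, G', f', g', h', hG', hK⟩ := ih
    obtain ⟨P, G'', i, p, hP, hi, hG''⟩ := hG'.properties.2.2
    obtain ⟨W, c, a, b, hc, hab⟩ := h'.exists_comp hi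
    have sq := IsPushout.of_hasPushout f a
    obtain ⟨d, -, hd⟩ := h.pushout_of_isPushout sq
    obtain ⟨d', -, hd'⟩ := hab.pushout_of_isPushout sq.flip
    refine ⟨W, _, _, d, hd, isGorensteinProjective_of_isSES hd' hG hG'', ?_⟩
    exact hc.choose_spec.hasProjectiveDimensionLT_X₃ n hK
      (hasProjectiveDimensionLT_of_ge P 1 (n + 1) (by lia))

lemma IsGorensteinProjective.subsingleton_ext_of_hasProjectiveDimensionLE {B : C}
    (hB : IsGorensteinProjective B) (n : ℕ) {K : C} (hK : HasProjectiveDimensionLE K n) (m : ℕ) :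
    Subsingleton (Abelian.Ext B K (m + 1)) := by
  induction n generalizing K m with
  | zero => exact hB.subsingleton_ext ((projective_iff_hasProjectiveDimensionLE_zero K).2 hK) m
  | succ n ih =>
    have h := IsSES.kernel_of_epi (Projective.π K)
    exact h.subsingleton_ext_of_covariant (hB.subsingleton_ext inferInstance m)
      (ih ((h.choose_spec.hasProjectiveDimensionLT_X₃_iff n inferInstance).1 hK) (m + 1))

lemma hasResDimLE_of_hasProjectiveDimensionLE (n : ℕ) {K : C} (hK : HasProjectiveDimensionLE K n) :
    HasResDimLE IsGorensteinProjective K n := by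
  induction n generalizing K with
  | zero =>
    exact .of_mem (isGorensteinProjective_of_projective
      ((projective_iff_hasProjectiveDimensionLE_zero K).2 hK)) 0
  | succ n ih =>
    have h := IsSES.kernel_of_epi (Projective.π K)
    exact .step n _ _ h (isGorensteinProjective_of_projective inferInstance)
      (ih ((h.choose_spec.hasProjectiveDimensionLT_X₃_iff n inferInstance).1 hK))

end Helpers

/-- Any object of finite G-dimension `n` admits a special right
`gpC`-approximation whose kernel has finite projective dimension (`= n - 1`
when `n > 0`). -/
theorem special_gp_approximation {C : Type u} [Category.{v} C] [Abelian C]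
    [EnoughProjectives C] [HasExt.{w} C]
    (X : C) (n : ℕ) (hX : gDim X = (n : ℕ∞)) :
    ∃ (K G : C) (f : K ⟶ G) (g : G ⟶ X),
      IsSES f g ∧ IsGorensteinProjective G ∧
      projDim K ≠ ⊤ ∧ (0 < n → projDim K = ((n - 1 : ℕ) : ℕ∞)) ∧
      (∀ B : C, IsGorensteinProjective B → Subsingleton (Abelian.Ext B K 1)) := by
  have hS : {n : ℕ∞ | ∃ m : ℕ, n = m ∧ HasResDimLE IsGorensteinProjective X m}.Nonempty := by
    by_contra hS
    rw [Set.not_nonempty_iff_eq_empty] at hS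
    simp [gDim, hS] at hX
  obtain ⟨m, hm, hres⟩ := csInf_mem hS
  obtain rfl : n = m := by exact_mod_cast hX.symm.trans hm
  obtain ⟨K, G, f, g, h, hG, hK⟩ := exists_isSES_of_hasResDimLE hres
  have hle : projDim K ≤ ((n - 1 : ℕ) : ℕ∞) :=
    (projDim_le_iff K _).2 (hasProjectiveDimensionLT_of_ge K n _ (by lia))
  refine ⟨K, G, f, g, h, hG, ne_top_of_le_ne_top (ENat.natCast_ne_top _) hle, fun hn => ?_,
    fun B hB => hB.subsingleton_ext_of_hasProjectiveDimensionLE n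
      (hasProjectiveDimensionLT_of_ge K n _ (by lia)) 0⟩
  refine le_antisymm hle (not_lt.1 fun hlt => ?_)
  obtain ⟨k, hk⟩ := ENat.ne_top_iff_exists.1 hlt.ne_top
  rw [← hk, Nat.cast_lt] at hlt
  have hres' := HasResDimLE.step k f g h hG
    (hasResDimLE_of_hasProjectiveDimensionLE k ((projDim_le_iff K k).1 hk.ge))
  have : gDim X ≤ ((k + 1 : ℕ) : ℕ∞) := sInf_le ⟨_, rfl, hres'⟩
  rw [hX, Nat.cast_le] at this
  lia
end

section
/- Let C be an abelian category with enough projectives and X an object of finite G-dimension. For any k∈ℕ, Gd_C X ≤ k if and only if Ext^j_C(X,P)=0 for all projective P and all j>k. -/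
open CategoryTheory CategoryTheory.Limits

universe w w' v v' u u'

section GorensteinProjective

variable {C : Type u} [Category.{v} C] [Abelian C]

lemma IsSES.of_iso_left_s13 {X X' Y Z : C} {f : X ⟶ Y} {g : Y ⟶ Z} (h : IsSES f g) (e : X' ≅ X) :
    IsSES (e.hom ≫ f) g := by
  obtain ⟨w, h⟩ := h
  have w' : (e.hom ≫ f) ≫ g = 0 := by simp [w]
  exact ⟨w', ShortComplex.shortExact_of_iso (S₁ := ShortComplex.mk f g w)
    (S₂ := ShortComplex.mk (e.hom ≫ f) g w')
    (ShortComplex.isoMk e.symm (Iso.refl _) (Iso.refl _)) h⟩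

lemma IsSES.of_iso_right_s13 {X Y Z Z' : C} {f : X ⟶ Y} {g : Y ⟶ Z} (h : IsSES f g) (e : Z ≅ Z') :
    IsSES f (g ≫ e.hom) := by
  obtain ⟨w, h⟩ := h
  have w' : f ≫ g ≫ e.hom = 0 := by simp [reassoc_of% w]
  exact ⟨w', ShortComplex.shortExact_of_iso (S₁ := ShortComplex.mk f g w)
    (S₂ := ShortComplex.mk f (g ≫ e.hom) w')
    (ShortComplex.isoMk (Iso.refl _) (Iso.refl _) e) h⟩

lemma isSES_kernel_ι {X Y : C} (f : X ⟶ Y) [Epi f] : IsSES (kernel.ι f) f :=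
  ⟨kernel.condition f, { exact := ShortComplex.exact_kernel f }⟩

lemma isSES_biprod (X Y : C) : IsSES (biprod.inl : X ⟶ X ⊞ Y) (biprod.snd : X ⊞ Y ⟶ Y) :=
  ⟨by simp, (ShortComplex.Splitting.ofHasBinaryBiproduct X Y).shortExact⟩

lemma isSES_biprod' (X Y : C) : IsSES (biprod.inr : Y ⟶ X ⊞ Y) (biprod.fst : X ⊞ Y ⟶ X) :=
  ⟨by simp, ShortComplex.Splitting.shortExact
    { r := biprod.snd
      s := biprod.inl
      id := by dsimp; rw [add_comm, biprod.total] }⟩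

lemma shortExact_L₃_of_snakeInput (S : ShortComplex.SnakeInput C)
    (h : Mono S.v₁₂.τ₃) (hg : Epi S.L₂.g) : S.L₃.ShortExact := by
  have hz : S.v₀₁.τ₃ = 0 := by
    rw [← cancel_mono S.v₁₂.τ₃, S.w₀₂_τ₃, zero_comp]
  have hz' : IsZero S.L₀.X₃ := by
    rw [IsZero.iff_id_eq_zero, ← cancel_mono S.v₀₁.τ₃, hz]; simp
  exact
    { exact := S.L₃_exact
      mono_f := S.L₂'_exact.mono_g (hz'.eq_of_src _ _)
      epi_g := inferInstance }

/-- The cokernels of a composable pair of monomorphisms and of their composition form a short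
exact sequence. -/
lemma exists_isSES_cokernel_comp {X Y Z Y' Z' : C} {f : X ⟶ Y} {g : Y ⟶ Z} {y : Y ⟶ Y'}
    {z : Z ⟶ Z'} (hf : IsSES f y) (hg : IsSES g z) :
    ∃ (W : C) (w : Z ⟶ W) (s : Y' ⟶ W) (t : W ⟶ Z'), IsSES (f ≫ g) w ∧ IsSES s t := by
  obtain ⟨wf, hf⟩ := hf
  obtain ⟨wg, hg⟩ := hg
  have : Mono f := hf.mono_f
  have : Mono g := hg.mono_f
  let S := kernelCokernelCompSequence.snakeInput f g
  have hS : IsSES S.L₃.f S.L₃.g := ⟨S.L₃.zero, shortExact_L₃_of_snakeInput S this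
    (inferInstanceAs (Epi (biprod.snd : Y ⊞ Z ⟶ Z)))⟩
  let e₁ : Y' ≅ cokernel f := (cokernelIsCokernel f).coconePointUniqueUpToIso hf.gIsCokernel |>.symm
  let e₃ : cokernel g ≅ Z' := (cokernelIsCokernel g).coconePointUniqueUpToIso hg.gIsCokernel
  exact ⟨_, _, _, _, isSES_cokernel_π (f ≫ g), (hS.of_iso_left_s13 e₁).of_iso_right_s13 e₃⟩

/-- The cokernels of a morphism of short exact sequences with outer components monic form a short
exact sequence. -/
lemma exists_isSES_cokernel {X₁ X₂ X₃ Y₁ Y₂ Y₃ Z₁ Z₃ : C} {f : X₁ ⟶ X₂} {g : X₂ ⟶ X₃}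
    {f' : Y₁ ⟶ Y₂} {g' : Y₂ ⟶ Y₃} {a₁ : X₁ ⟶ Y₁} (a₂ : X₂ ⟶ Y₂) {a₃ : X₃ ⟶ Y₃}
    {b₁ : Y₁ ⟶ Z₁} {b₃ : Y₃ ⟶ Z₃} (h : IsSES f g) (h' : IsSES f' g')
    (h₁ : IsSES a₁ b₁) (h₃ : IsSES a₃ b₃) (w₁ : a₁ ≫ f' = f ≫ a₂) (w₂ : a₂ ≫ g' = g ≫ a₃) :
    ∃ (W : C) (b₂ : Y₂ ⟶ W) (s : Z₁ ⟶ W) (t : W ⟶ Z₃), IsSES a₂ b₂ ∧ IsSES s t := by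
  obtain ⟨w, h⟩ := h
  obtain ⟨w', h'⟩ := h'
  obtain ⟨_, h₁⟩ := h₁
  obtain ⟨_, h₃⟩ := h₃
  let φ : ShortComplex.mk f g w ⟶ ShortComplex.mk f' g' w' := ⟨a₁, a₂, a₃, w₁, w₂⟩
  let S : ShortComplex.SnakeInput C :=
    { L₀ := kernel φ
      L₁ := _
      L₂ := _
      L₃ := cokernel φ
      v₀₁ := kernel.ι φ
      v₁₂ := φ
      v₂₃ := cokernel.π φ
      w₀₂ := kernel.condition φ
      w₁₃ := cokernel.condition φ
      h₀ := kernelIsKernel φ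
      h₃ := cokernelIsCokernel φ
      L₁_exact := h.exact
      epi_L₁_g := h.epi_g
      L₂_exact := h'.exact
      mono_L₂_f := h'.mono_f }
  have hS : IsSES S.L₃.f S.L₃.g := ⟨S.L₃.zero, shortExact_L₃_of_snakeInput S h₃.mono_f h'.epi_g⟩
  have : Mono φ.τ₁ := h₁.mono_f
  have : Mono φ.τ₃ := h₃.mono_f
  have : Mono (ShortComplex.mk f g w).f := h.mono_f
  have : Mono (ShortComplex.mk f' g' w').f := h'.mono_f
  have : Mono a₂ := ShortComplex.mono_τ₂_of_exact_of_mono φ h.exact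
  let e₁ : Z₁ ≅ S.L₃.X₁ := h₁.gIsCokernel.coconePointUniqueUpToIso S.h₃τ₁
  let e₃ : S.L₃.X₃ ≅ Z₃ := S.h₃τ₃.coconePointUniqueUpToIso h₃.gIsCokernel
  exact ⟨_, _, _, _, ⟨S.w₁₃_τ₂,
    { exact := S.exact_C₂_down, mono_f := this, epi_g := S.epi_v₂₃_τ₂ }⟩,
    (hS.of_iso_left_s13 e₁).of_iso_right_s13 e₃⟩

lemma isSES_cokernel_of_exactAt {P : ChainComplex C ℤ} {i j k : ℤ}
    (hij : j + 1 = i) (hjk : k + 1 = j) (h : P.ExactAt j) :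
    IsSES (cokernel.desc (P.d i j) (P.d j k) (P.d_comp_d i j k)) (cokernel.π (P.d j k)) := by
  have hex : (ShortComplex.mk (P.d i j) (P.d j k) (P.d_comp_d i j k)).Exact :=
    (P.exactAt_iff' i j k (by simp [hij]) (by simp [← hjk])).1 h
  have w : cokernel.desc (P.d i j) (P.d j k) (P.d_comp_d i j k) ≫ cokernel.π (P.d j k) = 0 := by
    ext; simp
  let φ : ShortComplex.mk (P.d j k) (cokernel.π (P.d j k)) (cokernel.condition _) ⟶
      ShortComplex.mk _ _ w := ⟨cokernel.π _, 𝟙 _, 𝟙 _, by simp, by simp⟩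
  have : Epi φ.τ₁ := by dsimp [φ]; infer_instance
  have : IsIso φ.τ₂ := by dsimp [φ]; infer_instance
  have : Mono φ.τ₃ := by dsimp [φ]; infer_instance
  exact ⟨w,
    { exact := (ShortComplex.exact_iff_of_epi_of_isIso_of_mono φ).1 (ShortComplex.exact_cokernel _)
      mono_f := hex.mono_cokernelDesc
      epi_g := by dsimp; infer_instance }⟩

section Ext

variable [HasExt.{w} C] {X Y Z : C} {f : X ⟶ Y} {g : Y ⟶ Z}

lemma IsSES.subsingleton_ext_mid (h : IsSES f g) {Q : C} {n : ℕ}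
    (hX : Subsingleton (Abelian.Ext.{w} X Q n)) (hZ : Subsingleton (Abelian.Ext.{w} Z Q n)) :
    Subsingleton (Abelian.Ext.{w} Y Q n) := by
  obtain ⟨w, h⟩ := h
  refine subsingleton_of_forall_eq 0 fun x ↦ ?_
  obtain ⟨y, rfl⟩ := Abelian.Ext.contravariant_sequence_exact₂ h Q x (hX.elim _ _)
  rw [hZ.elim y 0, Abelian.Ext.comp_zero]

lemma IsSES.subsingleton_ext_left (h : IsSES f g) {Q : C} {n : ℕ}
    (hY : Subsingleton (Abelian.Ext.{w} Y Q n))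
    (hZ : Subsingleton (Abelian.Ext.{w} Z Q (n + 1))) :
    Subsingleton (Abelian.Ext.{w} X Q n) := by
  obtain ⟨w, h⟩ := h
  refine subsingleton_of_forall_eq 0 fun x ↦ ?_
  obtain ⟨y, rfl⟩ := Abelian.Ext.contravariant_sequence_exact₁ h Q x (Nat.add_comm 1 n)
    (hZ.elim _ _)
  rw [hY.elim y 0, Abelian.Ext.comp_zero]

lemma IsSES.subsingleton_ext_right (h : IsSES f g) {Q : C} {n : ℕ}
    (hX : Subsingleton (Abelian.Ext.{w} X Q n))
    (hY : Subsingleton (Abelian.Ext.{w} Y Q (n + 1))) :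
    Subsingleton (Abelian.Ext.{w} Z Q (n + 1)) := by
  obtain ⟨w, h⟩ := h
  refine subsingleton_of_forall_eq 0 fun x ↦ ?_
  obtain ⟨y, rfl⟩ := Abelian.Ext.contravariant_sequence_exact₃ h Q x (hY.elim _ _)
    (Nat.add_comm 1 n)
  rw [hX.elim y 0, Abelian.Ext.comp_zero]

lemma IsSES.exists_extension_s13 (h : IsSES f g) {Q : C}
    (hZ : Subsingleton (Abelian.Ext.{w} Z Q 1)) (a : X ⟶ Q) : ∃ b : Y ⟶ Q, f ≫ b = a := by
  obtain ⟨w, h⟩ := h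
  obtain ⟨y, hy⟩ := Abelian.Ext.contravariant_sequence_exact₁ h Q (Abelian.Ext.mk₀ a) rfl
    (hZ.elim _ _)
  obtain ⟨b, rfl⟩ := (Abelian.Ext.mk₀_bijective Y Q).2 y
  rw [Abelian.Ext.mk₀_comp_mk₀] at hy
  exact ⟨b, (Abelian.Ext.mk₀_bijective X Q).1 hy⟩

lemma IsSES.subsingleton_ext_one_s13 (h : IsSES f g) {Q : C}
    (hY : Subsingleton (Abelian.Ext.{w} Y Q 1)) (hf : ∀ a : X ⟶ Q, ∃ b : Y ⟶ Q, f ≫ b = a) :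
    Subsingleton (Abelian.Ext.{w} Z Q 1) := by
  obtain ⟨w, h⟩ := h
  refine subsingleton_of_forall_eq 0 fun x ↦ ?_
  obtain ⟨y, rfl⟩ := Abelian.Ext.contravariant_sequence_exact₃ h Q x (hY.elim _ _)
    (Nat.add_zero 1)
  obtain ⟨a, rfl⟩ := (Abelian.Ext.mk₀_bijective X Q).2 y
  obtain ⟨b, rfl⟩ := hf a
  rw [← Abelian.Ext.mk₀_comp_mk₀]
  exact h.extClass_comp_assoc _

end Ext

section ExtOrthogonal

variable [HasExt.{w} C]

/-- The objects `X` such that `Ext^j(X, Q) = 0` for all projective `Q` and all `j > 0`. -/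
def IsExtOrthogonal (X : C) : Prop :=
  ∀ Q : C, Projective Q → ∀ j : ℕ, 0 < j → Subsingleton (Abelian.Ext.{w} X Q j)

lemma isExtOrthogonal_of_projective {P : C} (hP : Projective P) : IsExtOrthogonal.{w} P := by
  intro Q _ j hj
  obtain ⟨j, rfl⟩ := Nat.exists_eq_add_of_lt hj
  exact Abelian.Ext.subsingleton_of_projective P Q _

lemma IsExtOrthogonal.left {X Y Z : C} {f : X ⟶ Y} {g : Y ⟶ Z} (h : IsSES f g)
    (hY : IsExtOrthogonal.{w} Y) (hZ : IsExtOrthogonal.{w} Z) : IsExtOrthogonal.{w} X :=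
  fun Q hQ j hj ↦ h.subsingleton_ext_left (hY Q hQ j hj) (hZ Q hQ _ j.succ_pos)

lemma IsExtOrthogonal.mid {X Y Z : C} {f : X ⟶ Y} {g : Y ⟶ Z} (h : IsSES f g)
    (hX : IsExtOrthogonal.{w} X) (hZ : IsExtOrthogonal.{w} Z) : IsExtOrthogonal.{w} Y :=
  fun Q hQ j hj ↦ h.subsingleton_ext_mid (hX Q hQ j hj) (hZ Q hQ j hj)

lemma IsExtOrthogonal.of_iso {X Y : C} (e : X ≅ Y) (hX : IsExtOrthogonal.{w} X) :
    IsExtOrthogonal.{w} Y := by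
  intro Q hQ j hj
  have := hX Q hQ j hj
  refine ⟨fun a b ↦ ?_⟩
  have h := congrArg (fun x ↦ (Abelian.Ext.mk₀ e.inv).comp x (zero_add j))
    (this.elim ((Abelian.Ext.mk₀ e.hom).comp a (zero_add j))
      ((Abelian.Ext.mk₀ e.hom).comp b (zero_add j)))
  simpa using h

/-- `X` is a syzygy of `Y`: there is a short exact sequence `0 → X → P → Y → 0` with `P`
projective. -/
def IsSyzygy (X Y : C) : Prop :=
  ∃ (P : C) (f : X ⟶ P) (g : P ⟶ Y), Projective P ∧ IsSES f g

/-- A class of objects orthogonal to the projectives in which every object is a syzygy of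
another one. -/
def IsCosyzygyClosed (S : C → Prop) : Prop :=
  ∀ X, S X → IsExtOrthogonal.{w} X ∧ ∃ Y, IsSyzygy X Y ∧ S Y

lemma IsTotallyAcyclic.isExtOrthogonal {P : ChainComplex C ℤ} (hP : IsTotallyAcyclic P)
    {i k : ℤ} (hik : k + 1 = i) : IsExtOrthogonal.{w} (cokernel (P.d i k)) := by
  intro Q hQ j hj
  obtain ⟨j, rfl⟩ : ∃ n, j = n + 1 := ⟨j - 1, by lia⟩
  clear hj
  have hk := isExtOrthogonal_of_projective.{w} (hP.projective k)
  have hses := isSES_cokernel_of_exactAt rfl hik (hP.acyclic i)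
  induction j generalizing i k with
  | zero =>
    refine hses.subsingleton_ext_one_s13 (hk Q hQ 1 one_pos) fun a ↦ ?_
    obtain rfl : k = i - 1 := by lia
    obtain ⟨b, hb⟩ := hP.homExact Q hQ i (cokernel.π _ ≫ a) (by simp)
    exact ⟨b, by ext; simp [hb]⟩
  | succ j ih =>
    exact hses.subsingleton_ext_right (ih rfl (isExtOrthogonal_of_projective.{w} (hP.projective _))
      (isSES_cokernel_of_exactAt rfl rfl (hP.acyclic _))) (hk Q hQ _ (Nat.succ_pos _))

lemma isCosyzygyClosed_cokernel_d : IsCosyzygyClosed.{w} (fun X : C ↦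
    ∃ P : ChainComplex C ℤ, IsTotallyAcyclic P ∧
      ∃ i k : ℤ, k + 1 = i ∧ Nonempty (X ≅ cokernel (P.d i k))) := by
  rintro X ⟨P, hP, i, k, hik, ⟨e⟩⟩
  refine ⟨(hP.isExtOrthogonal hik).of_iso e.symm, cokernel (P.d k (k - 1)),
    ⟨_, _, _, hP.projective _, (isSES_cokernel_of_exactAt hik (by lia)
      (hP.acyclic k)).of_iso_left_s13 e⟩, P, hP, _, _, by lia, ⟨Iso.refl _⟩⟩

/-- Splicing short exact sequences with projective middle terms along `ℤ` yields a totally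
acyclic complex if the syzygies are orthogonal to the projectives. -/
lemma isGorensteinProjective_of_isSyzygy (Z : ℤ → C) (hZ : ∀ i, IsExtOrthogonal.{w} (Z i))
    (h : ∀ i, IsSyzygy (Z (i + 1)) (Z i)) : IsGorensteinProjective (Z 0) := by
  choose P f g hP hfg using h
  have hzero (i) : (g (i + 1) ≫ f i) ≫ g i = 0 := by
    obtain ⟨w, -⟩ := hfg i
    simp [w]
  have hmono (i) : Mono (f i) := (hfg i).2.mono_f
  have hepi (i) : Epi (g i) := (hfg i).2.epi_g
  have hexact (i) : (ShortComplex.mk (g (i + 1) ≫ f i) (g i) (hzero i)).Exact := by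
    obtain ⟨w, hi⟩ := hfg i
    let φ : ShortComplex.mk (g (i + 1) ≫ f i) (g i) (hzero i) ⟶ ShortComplex.mk _ _ w :=
      ⟨g (i + 1), 𝟙 _, 𝟙 _, by simp, by simp⟩
    have : Epi φ.τ₁ := hepi _
    have : IsIso φ.τ₂ := by dsimp [φ]; infer_instance
    have : Mono φ.τ₃ := by dsimp [φ]; infer_instance
    exact (ShortComplex.exact_iff_of_epi_of_isIso_of_mono φ).2 hi.exact
  have sq (i) : (g (i + 1 + 1) ≫ f (i + 1)) ≫ g (i + 1) ≫ f i = 0 := by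
    rw [← Category.assoc, hzero, zero_comp]
  have hd (i) : (ChainComplex.of P (fun i ↦ g (i + 1) ≫ f i) sq).d (i + 1) i =
      g (i + 1) ≫ f i := ChainComplex.of_d P (fun i ↦ g (i + 1) ≫ f i) i
  refine ⟨ChainComplex.of P (fun i ↦ g (i + 1) ≫ f i) sq, ⟨hP, fun i ↦ ?_, ?_⟩, ?_⟩
  · obtain ⟨i, rfl⟩ : ∃ j, i = j + 1 := ⟨i - 1, by lia⟩
    rw [HomologicalComplex.exactAt_iff' _ (i + 1 + 1) (i + 1) i (by simp) (by simp)]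
    let φ : ShortComplex.mk (g (i + 1 + 1) ≫ f (i + 1)) (g (i + 1)) (hzero (i + 1)) ⟶
        (ChainComplex.of P (fun i ↦ g (i + 1) ≫ f i) sq).sc' (i + 1 + 1) (i + 1) i :=
      ⟨𝟙 _, 𝟙 _, f i, (Category.id_comp _).trans ((hd (i + 1)).trans (Category.comp_id _).symm),
        (Category.id_comp _).trans (hd i)⟩
    have : Epi φ.τ₁ := inferInstanceAs (Epi (𝟙 (P (i + 1 + 1))))
    have : IsIso φ.τ₂ := inferInstanceAs (IsIso (𝟙 (P (i + 1))))
    have : Mono φ.τ₃ := hmono i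
    exact (ShortComplex.exact_iff_of_epi_of_isIso_of_mono φ).1 (hexact (i + 1))
  · intro Q hQ i a ha
    obtain ⟨i, rfl⟩ : ∃ j, i = j + 1 := ⟨i - 1, by lia⟩
    obtain ⟨k, hk⟩ : ∃ k, k = i + 1 - 1 := ⟨_, rfl⟩
    rw [← hk]
    obtain rfl : k = i := by lia
    rw [hd] at ha ⊢
    obtain ⟨b, hb⟩ : ∃ b : Z (k + 1) ⟶ Q, g (k + 1) ≫ b = a :=
      ⟨(hexact (k + 1)).desc a ha, (hexact (k + 1)).g_desc a ha⟩
    obtain ⟨c, hc⟩ := (hfg k).exists_extension_s13 (hZ k Q hQ 1 one_pos) b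
    exact ⟨c, by rw [Category.assoc, hc, hb]⟩
  · suffices ∀ k, 0 + 1 = k →
        Nonempty (Z 0 ≅ cokernel ((ChainComplex.of P (fun i ↦ g (i + 1) ≫ f i) sq).d k 0)) from
      this 1 rfl
    rintro _ rfl
    exact ⟨(hexact 0).gIsCokernel.coconePointUniqueUpToIso (cokernelIsCokernel _) ≪≫
      cokernelIsoOfEq (hd 0).symm⟩

/-- Horseshoe lemma for embeddings into projective objects. -/
lemma IsSES.exists_isSyzygy_mid {X Y Z X' Z' : C} {f : X ⟶ Y} {g : Y ⟶ Z} (h : IsSES f g)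
    (hZ : IsExtOrthogonal.{w} Z) (hX' : IsSyzygy X X') (hZ' : IsSyzygy Z Z') :
    ∃ (Y' : C) (s : X' ⟶ Y') (t : Y' ⟶ Z'), IsSyzygy Y Y' ∧ IsSES s t := by
  obtain ⟨P, a, a', hP, ha⟩ := hX'
  obtain ⟨Q, c, c', hQ, hc⟩ := hZ'
  obtain ⟨b, hb⟩ := h.exists_extension_s13 (hZ P hP 1 one_pos) a
  obtain ⟨w, -⟩ := id h
  obtain ⟨W, y, s, t, hy, hst⟩ := exists_isSES_cokernel (biprod.lift (g ≫ c) b) h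
    (isSES_biprod' Q P) ha hc (by ext <;> simp [hb, reassoc_of% w]) (by simp)
  exact ⟨W, s, t, ⟨_, _, _, inferInstance, hy⟩, hst⟩

variable [EnoughProjectives C]

lemma IsExtOrthogonal.exists_isSyzygy {X : C} (hX : IsExtOrthogonal.{w} X) :
    ∃ K : C, IsSyzygy K X ∧ IsExtOrthogonal.{w} K :=
  ⟨_, ⟨_, _, _, inferInstance, isSES_kernel_ι (Projective.π X)⟩,
    .left (isSES_kernel_ι (Projective.π X))
      (isExtOrthogonal_of_projective inferInstance) hX⟩

lemma IsCosyzygyClosed.isGorensteinProjective {S : C → Prop}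
    (hS : IsCosyzygyClosed.{w} S) {X : C} (hX : S X) : IsGorensteinProjective X := by
  choose! L hL hL' using fun (Y : C) (hY : IsExtOrthogonal.{w} Y) ↦ hY.exists_isSyzygy
  choose! hS R hR hR' using hS
  have hl (n : ℕ) : IsExtOrthogonal.{w} (L^[n] X) := by
    induction n with
    | zero => exact hS X hX
    | succ n ih => rw [Function.iterate_succ_apply']; exact hL' _ ih
  have hr (n : ℕ) : S (R^[n] X) := by
    induction n with
    | zero => exact hX
    | succ n ih => rw [Function.iterate_succ_apply']; exact hR' _ ih
  let Z : ℤ → C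
    | .ofNat n => L^[n] X
    | .negSucc n => R^[n + 1] X
  refine isGorensteinProjective_of_isSyzygy.{w} Z ?_ ?_
  · rintro (n | n)
    · exact hl n
    · exact hS _ (hr (n + 1))
  · rintro (n | _ | n)
    · change IsSyzygy (L^[n + 1] X) (L^[n] X)
      rw [Function.iterate_succ_apply']
      exact hL _ (hl n)
    · exact hR X hX
    · change IsSyzygy (R^[n + 1] X) (R^[n + 1 + 1] X)
      rw [Function.iterate_succ_apply' R (n + 1)]
      exact hR _ (hr (n + 1))

variable (C) in
lemma isCosyzygyClosed_isGorensteinProjective :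
    IsCosyzygyClosed.{w} (IsGorensteinProjective (C := C)) := by
  rintro X ⟨P, hP, e⟩
  obtain ⟨hX, Y, hXY, hY⟩ := isCosyzygyClosed_cokernel_d.{w} X ⟨P, hP, 1, 0, rfl, e⟩
  exact ⟨hX, Y, hXY, isCosyzygyClosed_cokernel_d.{w}.isGorensteinProjective hY⟩

lemma IsExtOrthogonal.isGorensteinProjective {X Y : C} (hX : IsExtOrthogonal.{w} X)
    (hXY : IsSyzygy X Y) (hY : IsGorensteinProjective Y) : IsGorensteinProjective X := by
  have hG := isCosyzygyClosed_isGorensteinProjective.{w} C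
  refine IsCosyzygyClosed.isGorensteinProjective.{w} (S := fun Z ↦
    IsExtOrthogonal.{w} Z ∧ ∃ W, IsSyzygy Z W ∧ IsGorensteinProjective W)
    ?_ ⟨hX, Y, hXY, hY⟩
  rintro Z ⟨hZ, W, hZW, hW⟩
  exact ⟨hZ, W, hZW, hG W hW⟩

lemma IsSES.isGorensteinProjective_mid {X Y Z : C} {f : X ⟶ Y} {g : Y ⟶ Z} (h : IsSES f g)
    (hX : IsGorensteinProjective X) (hZ : IsGorensteinProjective Z) :
    IsGorensteinProjective Y := by
  have hG := isCosyzygyClosed_isGorensteinProjective.{w} C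
  refine IsCosyzygyClosed.isGorensteinProjective.{w} (S := fun Y ↦
    ∃ (X Z : C) (f : X ⟶ Y) (g : Y ⟶ Z), IsSES f g ∧ IsGorensteinProjective X ∧
      IsGorensteinProjective Z) ?_ ⟨X, Z, f, g, h, hX, hZ⟩
  rintro Y ⟨X, Z, f, g, h, hX, hZ⟩
  obtain ⟨hX, X', hXX', hX'⟩ := hG X hX
  obtain ⟨hZ, Z', hZZ', hZ'⟩ := hG Z hZ
  obtain ⟨Y', s, t, hYY', hst⟩ := h.exists_isSyzygy_mid hZ hXX' hZZ'
  exact ⟨hX.mid h hZ, Y', hYY', X', Z', s, t, hst, hX', hZ'⟩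

lemma isGorensteinProjective_of_projective_s13 {P : C} (hP : Projective P) :
    IsGorensteinProjective P := by
  refine IsCosyzygyClosed.isGorensteinProjective.{w} (S := Projective) ?_ hP
  intro P hP
  exact ⟨isExtOrthogonal_of_projective hP, P, ⟨_, _, _, inferInstance, isSES_biprod P P⟩, hP⟩

/-- The cokernel of a monomorphism between Gorenstein projective objects is Gorenstein projective
as soon as it is orthogonal to the projectives. -/
lemma IsSES.isGorensteinProjective_right {K G X : C} {f : K ⟶ G} {g : G ⟶ X} (h : IsSES f g)
    (hK : IsGorensteinProjective K) (hG : IsGorensteinProjective G)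
    (hX : IsExtOrthogonal.{w} X) : IsGorensteinProjective X := by
  have hcl := isCosyzygyClosed_isGorensteinProjective.{w} C
  obtain ⟨-, K', ⟨P, a, a', hP, ha⟩, hK'⟩ := hcl K hK
  obtain ⟨b, hb⟩ := h.exists_extension_s13 (hX P hP 1 one_pos) a
  obtain ⟨w, -⟩ := id h
  have hXP : IsGorensteinProjective (X ⊞ P) := by
    obtain ⟨W, y, s, t, hy, hst⟩ := exists_isSES_cokernel (biprod.lift g b) h
      (isSES_biprod' X P) ha (isSES_cokernel_π (𝟙 X)) (by ext <;> simp [hb, w]) (by simp)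
    have : IsIso s := (hst.2.isIso_f_iff).2 (isZero_cokernel_of_epi _)
    exact (hy.of_iso_right_s13 (asIso s).symm).isGorensteinProjective_mid.{w} hG hK'
  obtain ⟨-, E, ⟨Q, c, c', hQ, hc⟩, hE⟩ := hcl _ hXP
  obtain ⟨W, y, s, t, hy, hst⟩ := exists_isSES_cokernel_comp (isSES_biprod X P) hc
  exact hX.isGorensteinProjective ⟨_, _, _, hQ, hy⟩
    (hst.isGorensteinProjective_mid.{w} (isGorensteinProjective_of_projective_s13.{w} hP) hE)

lemma IsGorensteinProjective.isExtOrthogonal {X : C} (hX : IsGorensteinProjective X) :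
    IsExtOrthogonal.{w} X :=
  (isCosyzygyClosed_isGorensteinProjective.{w} C X hX).1

lemma HasResDimLE.subsingleton_ext {X : C} {k : ℕ} (h : HasResDimLE IsGorensteinProjective X k)
    {P : C} (hP : Projective P) {j : ℕ} (hj : k < j) :
    Subsingleton (Abelian.Ext.{w} X P j) := by
  induction h generalizing j with
  | of_mem hX n => exact hX.isExtOrthogonal P hP j (by lia)
  | step n f g hses hG _ ih =>
    obtain ⟨j, rfl⟩ : ∃ i, j = i + 1 := ⟨j - 1, by lia⟩
    exact hses.subsingleton_ext_right (ih (by lia)) (hG.isExtOrthogonal P hP _ j.succ_pos)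

lemma HasResDimLE.of_subsingleton_ext {X : C} {m : ℕ}
    (h : HasResDimLE IsGorensteinProjective X m) {k : ℕ}
    (hk : ∀ P : C, Projective P → ∀ j : ℕ, k < j → Subsingleton (Abelian.Ext.{w} X P j)) :
    HasResDimLE IsGorensteinProjective X k := by
  induction h generalizing k with
  | of_mem hX n => exact .of_mem hX k
  | step n f g hses hG _ ih =>
    cases k with
    | zero =>
      have hK := ih (k := 0) (hG.isExtOrthogonal.left hses hk)
      cases hK with
      | of_mem hK => exact .of_mem (hses.isGorensteinProjective_right hK hG hk) 0
    | succ k =>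
      exact .step k f g hses hG (ih fun P hP j hj ↦ hses.subsingleton_ext_left
        (hG.isExtOrthogonal P hP j (by lia)) (hk P hP (j + 1) (by lia)))

end ExtOrthogonal

end GorensteinProjective

/-- For an object of finite G-dimension, `Gd X ≤ k` iff `Ext^j(X, P)` vanishes
for all projectives `P` and `j > k`. -/
theorem gdim_le_iff_ext_vanish {C : Type u} [Category.{v} C] [Abelian C]
    [EnoughProjectives C] [HasExt.{w} C]
    (X : C) (hX : gDim X ≠ ⊤) (k : ℕ) :
    HasResDimLE IsGorensteinProjective X k ↔
      ∀ P : C, Projective P → ∀ j : ℕ, k < j →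
        Subsingleton (Abelian.Ext X P j) := by
  obtain ⟨m, hm⟩ : ∃ m : ℕ, HasResDimLE IsGorensteinProjective X m := by
    by_contra! h
    exact hX (by simp [gDim, h])
  exact ⟨fun h P hP j hj ↦ h.subsingleton_ext hP hj, fun h ↦ hm.of_subsingleton_ext h⟩
end
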